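/- Let G be a unicyclic graph with at least two branch-active vertices, i.e. b(G) ≥ 2. Then dim(G) = L(G) + Δ, where Δ = 0 if G contains none of the configurations A, B, C with respect to a smallest branch-resolving set (equivalently, with respect to every smallest branch-resolving set), and Δ = 1 otherwise. -/

import Mathlib

open SimpleGraph

section Defs

variable {V : Type*}

/-- Distance from a vertex `s` to an edge `e`: the minimum of the distances to its endpoints. -/
noncomputable def edgeDist (G : SimpleGraph V) (s : V) (e : Sym2 V) : ℕ :=
  Sym2.lift ⟨fun u w => min (G.dist s u) (G.dist s w), fun u w => min_comm _ _⟩ e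

/-- `S` is a vertex metric generator of `G`. -/
def IsVertexMG (G : SimpleGraph V) (S : Set V) : Prop :=
  ∀ u v : V, u ≠ v → ∃ s ∈ S, G.dist s u ≠ G.dist s v

/-- `S` is an edge metric generator of `G`. -/
def IsEdgeMG (G : SimpleGraph V) (S : Set V) : Prop :=
  ∀ e ∈ G.edgeSet, ∀ f ∈ G.edgeSet, e ≠ f → ∃ s ∈ S, edgeDist G s e ≠ edgeDist G s f

/-- The vertex metric dimension of `G`. -/
noncomputable def metricDim (G : SimpleGraph V) : ℕ :=
  sInf {n | ∃ S : Finset V, S.card = n ∧ IsVertexMG G ↑S}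

/-- The edge metric dimension of `G`. -/
noncomputable def edgeMetricDim (G : SimpleGraph V) : ℕ :=
  sInf {n | ∃ S : Finset V, S.card = n ∧ IsEdgeMG G ↑S}

/-- `G` is unicyclic: connected, contains a cycle, and any two cycles have the same edges. -/
def IsUnicyclic (G : SimpleGraph V) : Prop :=
  G.Connected ∧ (∃ (u : V) (w : G.Walk u u), w.IsCycle) ∧
    ∀ (u u' : V) (w : G.Walk u u) (w' : G.Walk u' u'), w.IsCycle → w'.IsCycle →
      ∀ e, e ∈ w.edges ↔ e ∈ w'.edges

/-- `vc : ZMod g → V` is a labelling `v_0 v_1 ⋯ v_{g-1}` of a cycle of length `g` in `G`. -/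
def IsCycleLabelling (G : SimpleGraph V) (g : ℕ) (vc : ZMod g → V) : Prop :=
  Function.Injective vc ∧ ∀ i : ZMod g, G.Adj (vc i) (vc (i + 1))

/-- The set of edges of the cycle `C`. -/
def cycleEdges (g : ℕ) (vc : ZMod g → V) : Set (Sym2 V) :=
  {e | ∃ i : ZMod g, e = s(vc i, vc (i + 1))}

/-- The graph `G - E(C)`. -/
def offCycle (G : SimpleGraph V) (g : ℕ) (vc : ZMod g → V) : SimpleGraph V :=
  G.deleteEdges (cycleEdges g vc)

/-- `x` belongs to `T_{v_i}`, the connected component of `G - E(C)` containing `v_i`. -/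
def inTree (G : SimpleGraph V) (g : ℕ) (vc : ZMod g → V) (i : ZMod g) (x : V) : Prop :=
  (offCycle G g vc).Reachable (vc i) x

/-- The vertex `v_i` of the cycle is `S`-active: `T_{v_i}` contains a vertex of `S`. -/
def SActive (G : SimpleGraph V) (g : ℕ) (vc : ZMod g → V) (S : Set V) (i : ZMod g) : Prop :=
  ∃ s ∈ S, inTree G g vc i s

/-- `a_S(C)`: the number of `S`-active vertices on the cycle. -/
noncomputable def aS (G : SimpleGraph V) (g : ℕ) (vc : ZMod g → V) (S : Set V) : ℕ :=
  {i : ZMod g | SActive G g vc S i}.ncard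

/-- `S` is biactive: `a_S(C) ≥ 2`. -/
def Biactive (G : SimpleGraph V) (g : ℕ) (vc : ZMod g → V) (S : Set V) : Prop :=
  2 ≤ aS G g vc S

variable [Fintype V] [DecidableEq V]

/-- `t = u_1 u_2 ⋯ u_k` is a thread hanging at the vertex `v`. -/
def IsThreadAt (G : SimpleGraph V) [DecidableRel G.Adj] (v : V) (t : List V) : Prop :=
  t ≠ [] ∧ t.Nodup ∧ v ∉ t ∧ 3 ≤ G.degree v ∧ List.Chain' G.Adj t ∧
    (∀ u ∈ t.head?, G.Adj v u) ∧ (∀ u ∈ t.getLast?, G.degree u = 1) ∧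
    ∀ u ∈ t.dropLast, G.degree u = 2

/-- The thread `t` is `S`-free: it contains no vertex of `S`. -/
def SFree (S : Set V) (t : List V) : Prop := ∀ u ∈ t, u ∉ S

/-- `S` is branch-resolving: for every vertex, all threads hanging at it except possibly
one contain a vertex of `S` (i.e. at most one thread at each vertex is `S`-free). -/
def BranchResolving (G : SimpleGraph V) [DecidableRel G.Adj] (S : Set V) : Prop :=
  ∀ v : V, ∀ t₁ t₂ : List V, IsThreadAt G v t₁ → IsThreadAt G v t₂ → t₁ ≠ t₂ →
    (∃ s ∈ S, s ∈ t₁) ∨ (∃ s ∈ S, s ∈ t₂)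

/-- `ℓ(v)`: the number of threads hanging at `v`. -/
noncomputable def numThreads (G : SimpleGraph V) [DecidableRel G.Adj] (v : V) : ℕ :=
  {t : List V | IsThreadAt G v t}.ncard

/-- `L(G) = Σ (ℓ(v) - 1)` (truncated subtraction makes the sum run exactly over the
vertices with `ℓ(v) > 1`). -/
noncomputable def LG (G : SimpleGraph V) [DecidableRel G.Adj] : ℕ :=
  ∑ v : V, (numThreads G v - 1)

/-- `x` is a branching vertex of the unicyclic graph with cycle `vc`. -/
def Branching (G : SimpleGraph V) [DecidableRel G.Adj] (g : ℕ) (vc : ZMod g → V) (x : V) :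
    Prop :=
  (x ∉ Set.range vc ∧ 3 ≤ G.degree x) ∨ (x ∈ Set.range vc ∧ 4 ≤ G.degree x)

/-- The cycle vertex `v_i` is branch-active: `T_{v_i}` contains a branching vertex. -/
def BranchActive (G : SimpleGraph V) [DecidableRel G.Adj] (g : ℕ) (vc : ZMod g → V)
    (i : ZMod g) : Prop :=
  ∃ x, inTree G g vc i x ∧ Branching G g vc x

/-- `b(G)`: the number of branch-active vertices on the cycle. -/
noncomputable def bG (G : SimpleGraph V) [DecidableRel G.Adj] (g : ℕ) (vc : ZMod g → V) : ℕ :=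
  {i : ZMod g | BranchActive G g vc i}.ncard

/-- `k = max { i : v_i is S-active }` for the labelling `vc` (indices taken in `[0, g-1]`). -/
noncomputable def kOf (G : SimpleGraph V) (g : ℕ) (vc : ZMod g → V) (S : Set V) : ℕ :=
  sSup {n : ℕ | n < g ∧ SActive G g vc S (n : ZMod g)}

/-- The labelling `vc` of the cycle is canonical with respect to `S`: `v_0` is `S`-active
and `k` is as small as possible among all labellings of the cycle with `v_0` `S`-active. -/
def Canonical (G : SimpleGraph V) (g : ℕ) (vc : ZMod g → V) (S : Set V) : Prop :=
  IsCycleLabelling G g vc ∧ SActive G g vc S 0 ∧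
    ∀ vc' : ZMod g → V, IsCycleLabelling G g vc' → Set.range vc' = Set.range vc →
      SActive G g vc' S 0 → kOf G g vc S ≤ kOf G g vc' S

/-- Configuration 𝒜 : `a_S(C) = 2`, `g` even and `k = g/2`. -/
def ConfigA (G : SimpleGraph V) (g : ℕ) (vc : ZMod g → V) (S : Set V) : Prop :=
  aS G g vc S = 2 ∧ Even g ∧ kOf G g vc S = g / 2

/-- Configuration ℬ : `k ≤ ⌊g/2⌋ - 1` and an `S`-free thread hangs at `v_i` for some
`i ∈ [k, ⌊g/2⌋-1] ∪ [⌈g/2⌉+k+1, g-1] ∪ {0}`. -/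
def ConfigB (G : SimpleGraph V) [DecidableRel G.Adj] (g : ℕ) (vc : ZMod g → V) (S : Set V) :
    Prop :=
  kOf G g vc S ≤ g / 2 - 1 ∧
    ∃ i : ℕ, ((kOf G g vc S ≤ i ∧ i ≤ g / 2 - 1) ∨
        ((g + 1) / 2 + kOf G g vc S + 1 ≤ i ∧ i ≤ g - 1) ∨ i = 0) ∧
      ∃ t : List V, IsThreadAt G (vc (i : ZMod g)) t ∧ SFree S t

/-- Configuration 𝒞 : `a_S(C) = 2`, `g` even, `k ≤ g/2` and an `S`-free thread of length
`≥ g/2 - k` hangs at `v_i` for some `i ∈ [0, k]`. -/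
def ConfigC (G : SimpleGraph V) [DecidableRel G.Adj] (g : ℕ) (vc : ZMod g → V) (S : Set V) :
    Prop :=
  aS G g vc S = 2 ∧ Even g ∧ kOf G g vc S ≤ g / 2 ∧
    ∃ i : ℕ, i ≤ kOf G g vc S ∧
      ∃ t : List V, IsThreadAt G (vc (i : ZMod g)) t ∧ SFree S t ∧
        g / 2 - kOf G g vc S ≤ t.length

/-- Configuration 𝒟 : `k ≤ ⌈g/2⌉ - 1` and an `S`-free thread hangs at `v_i` for some
`i ∈ [k, ⌈g/2⌉-1] ∪ [⌊g/2⌋+k+1, g-1] ∪ {0}`. -/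
def ConfigD (G : SimpleGraph V) [DecidableRel G.Adj] (g : ℕ) (vc : ZMod g → V) (S : Set V) :
    Prop :=
  kOf G g vc S ≤ (g + 1) / 2 - 1 ∧
    ∃ i : ℕ, ((kOf G g vc S ≤ i ∧ i ≤ (g + 1) / 2 - 1) ∨
        (g / 2 + kOf G g vc S + 1 ≤ i ∧ i ≤ g - 1) ∨ i = 0) ∧
      ∃ t : List V, IsThreadAt G (vc (i : ZMod g)) t ∧ SFree S t

/-- Configuration ℰ : `a_S(C) = 2` and an `S`-free thread of length `≥ ⌊g/2⌋ - k + 1`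
hangs at `v_i` with `i ∈ [0, k]`; moreover if `g` is even an `S`-free thread hangs at
`v_j` with `j = g/2 + k - i`. -/
def ConfigE (G : SimpleGraph V) [DecidableRel G.Adj] (g : ℕ) (vc : ZMod g → V) (S : Set V) :
    Prop :=
  aS G g vc S = 2 ∧
    ∃ i : ℕ, i ≤ kOf G g vc S ∧
      (∃ t : List V, IsThreadAt G (vc (i : ZMod g)) t ∧ SFree S t ∧
        g / 2 - kOf G g vc S + 1 ≤ t.length) ∧
      (Even g → ∃ t' : List V,
        IsThreadAt G (vc ((g / 2 + kOf G g vc S - i : ℕ) : ZMod g)) t' ∧ SFree S t')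

/-- `G` contains configuration 𝒜 with respect to `S` (evaluated on a canonical labelling
of the cycle given by `vc`). -/
def ContainsA (G : SimpleGraph V) (g : ℕ) (vc : ZMod g → V) (S : Set V) : Prop :=
  ∃ vc' : ZMod g → V, IsCycleLabelling G g vc' ∧ Set.range vc' = Set.range vc ∧
    Canonical G g vc' S ∧ ConfigA G g vc' S

/-- `G` contains configuration ℬ with respect to `S`. -/
def ContainsB (G : SimpleGraph V) [DecidableRel G.Adj] (g : ℕ) (vc : ZMod g → V)
    (S : Set V) : Prop :=
  ∃ vc' : ZMod g → V, IsCycleLabelling G g vc' ∧ Set.range vc' = Set.range vc ∧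
    Canonical G g vc' S ∧ ConfigB G g vc' S

/-- `G` contains configuration 𝒞 with respect to `S`. -/
def ContainsC (G : SimpleGraph V) [DecidableRel G.Adj] (g : ℕ) (vc : ZMod g → V)
    (S : Set V) : Prop :=
  ∃ vc' : ZMod g → V, IsCycleLabelling G g vc' ∧ Set.range vc' = Set.range vc ∧
    Canonical G g vc' S ∧ ConfigC G g vc' S

/-- `G` contains configuration 𝒟 with respect to `S`. -/
def ContainsD (G : SimpleGraph V) [DecidableRel G.Adj] (g : ℕ) (vc : ZMod g → V)
    (S : Set V) : Prop :=
  ∃ vc' : ZMod g → V, IsCycleLabelling G g vc' ∧ Set.range vc' = Set.range vc ∧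
    Canonical G g vc' S ∧ ConfigD G g vc' S

/-- `G` contains configuration ℰ with respect to `S`. -/
def ContainsE (G : SimpleGraph V) [DecidableRel G.Adj] (g : ℕ) (vc : ZMod g → V)
    (S : Set V) : Prop :=
  ∃ vc' : ZMod g → V, IsCycleLabelling G g vc' ∧ Set.range vc' = Set.range vc ∧
    Canonical G g vc' S ∧ ConfigE G g vc' S

/-- `G` contains one of the configurations 𝒜, ℬ, 𝒞 with respect to `S`. -/
def ContainsABC (G : SimpleGraph V) [DecidableRel G.Adj] (g : ℕ) (vc : ZMod g → V)
    (S : Set V) : Prop :=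
  ContainsA G g vc S ∨ ContainsB G g vc S ∨ ContainsC G g vc S

/-- `G` contains one of the configurations 𝒜, 𝒟, ℰ with respect to `S`. -/
def ContainsADE (G : SimpleGraph V) [DecidableRel G.Adj] (g : ℕ) (vc : ZMod g → V)
    (S : Set V) : Prop :=
  ContainsA G g vc S ∨ ContainsD G g vc S ∨ ContainsE G g vc S

/-- `S` is a smallest branch-resolving set of `G`. -/
def SmallestBR (G : SimpleGraph V) [DecidableRel G.Adj] (S : Finset V) : Prop :=
  BranchResolving G ↑S ∧ ∀ S' : Finset V, BranchResolving G ↑S' → S.card ≤ S'.card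

/-- `S` is a smallest biactive branch-resolving set of `G`. -/
def SmallestBBR (G : SimpleGraph V) [DecidableRel G.Adj] (g : ℕ) (vc : ZMod g → V)
    (S : Finset V) : Prop :=
  BranchResolving G ↑S ∧ Biactive G g vc ↑S ∧
    ∀ S' : Finset V, BranchResolving G ↑S' → Biactive G g vc ↑S' → S.card ≤ S'.card

/-- `G` is 𝒜ℬ𝒞-negative. -/
def ABCneg (G : SimpleGraph V) [DecidableRel G.Adj] (g : ℕ) (vc : ZMod g → V) : Prop :=
  ∃ S : Finset V, SmallestBBR G g vc S ∧ ¬ ContainsABC G g vc ↑S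

/-- `G` is 𝒜𝒟ℰ-negative. -/
def ADEneg (G : SimpleGraph V) [DecidableRel G.Adj] (g : ℕ) (vc : ZMod g → V) : Prop :=
  ∃ S : Finset V, SmallestBBR G g vc S ∧ ¬ ContainsADE G g vc ↑S

end Defs

section Branch

variable {V : Type*} {G : SimpleGraph V}

theorem SimpleGraph.Reachable.mem_of_closed {a b : V} (h : G.Reachable a b) {X : Set V}
    (ha : a ∈ X) (hX : ∀ x ∈ X, ∀ y, G.Adj x y → y ∈ X) : b ∈ X := by
  obtain ⟨w⟩ := h
  induction w with
  | nil => exact ha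
  | cons hadj _ ih => exact ih (hX _ ha _ hadj)

/-- If every edge leaving `X` ends in `z`, geodesics from outside into `X` pass through `z`. -/
theorem dist_eq_add_of_cut (hG : G.Connected) {X : Set V} {z : V} (hz : z ∉ X)
    (hX : ∀ a ∈ X, ∀ b ∉ X, G.Adj a b → b = z) {s x : V} (hs : s ∉ X) (hx : x ∈ X) :
    G.dist s x = G.dist s z + G.dist z x := by
  apply le_antisymm hG.dist_triangle
  have key : ∀ (x s : V) (p : G.Walk x s), x ∈ X → s ∉ X →
      G.dist s z + G.dist z x ≤ p.length := by
    intro x s p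
    induction p with
    | nil => intro h1 h2; exact absurd h1 h2
    | @cons a b c hadj p ih =>
      intro h1 h2
      rw [Walk.length_cons]
      by_cases hb : b ∈ X
      · have h3 := ih hb h2
        have h4 : G.dist z a ≤ G.dist z b + G.dist b a := hG.dist_triangle
        have h5 : G.dist b a = 1 := dist_eq_one_iff_adj.2 hadj.symm
        omega
      · obtain rfl := hX _ h1 _ hb hadj
        have h5 : G.dist b a = 1 := dist_eq_one_iff_adj.2 hadj.symm
        have h6 : G.dist c b ≤ p.length := by
          rw [dist_comm]; exact dist_le p
        omega
  obtain ⟨p, hp⟩ := hG.exists_walk_length_eq_dist x s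
  have := key x s p hx hs
  rw [hp, dist_comm (u := x)] at this
  exact this

/-- The component of `u` once the edge `zu` is removed. -/
def branch (G : SimpleGraph V) (z u : V) : Set V :=
  {x | (G.deleteEdges {s(z, u)}).Reachable u x}

theorem mem_branch_self (z u : V) : u ∈ branch G z u := Reachable.refl _

theorem mem_branch_of_adj {z u a b : V} (ha : a ∈ branch G z u) (hab : G.Adj a b)
    (hne : s(a, b) ≠ s(z, u)) : b ∈ branch G z u := by
  refine Reachable.trans ha (Adj.reachable ?_)
  rw [deleteEdges_adj]
  exact ⟨hab, by simpa using hne⟩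

theorem branch_subset {z u : V} {X : Set V} (hu : u ∈ X)
    (hX : ∀ x ∈ X, x ∈ branch G z u → ∀ y, G.Adj x y → s(x, y) ≠ s(z, u) → y ∈ X) :
    branch G z u ⊆ X := by
  intro x hx
  have : x ∈ X ∩ branch G z u := by
    refine Reachable.mem_of_closed hx ⟨hu, mem_branch_self z u⟩ ?_
    rintro a ⟨ha, ha'⟩ b hab
    rw [deleteEdges_adj] at hab
    have hne : s(a, b) ≠ s(z, u) := by simpa using hab.2
    exact ⟨hX a ha ha' b hab.1 hne, mem_branch_of_adj ha' hab.1 hne⟩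
  exact this.1

theorem branch_boundary {z u a b : V} (hz : z ∉ branch G z u) (ha : a ∈ branch G z u)
    (hb : b ∉ branch G z u) (hab : G.Adj a b) : a = u ∧ b = z := by
  by_contra h
  apply hb
  apply mem_branch_of_adj ha hab
  intro he
  rcases Sym2.eq_iff.1 he with ⟨h1, -⟩ | ⟨h1, h2⟩
  · exact hz (h1 ▸ ha)
  · exact h ⟨h1, h2⟩

theorem eq_or_mem_branch {z u x : V} (hx : x ∈ branch G z u) :
    x = u ∨ ∃ w, G.Adj u w ∧ w ≠ z ∧ x ∈ branch G u w := by
  refine branch_subset (X := {x | x = u ∨ ∃ w, G.Adj u w ∧ w ≠ z ∧ x ∈ branch G u w})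
    (Or.inl rfl) ?_ hx
  intro a ha _ b hab hne
  rcases eq_or_ne a u with rfl | hau
  · refine Or.inr ⟨b, hab, ?_, mem_branch_self _ _⟩
    rintro rfl
    exact hne Sym2.eq_swap
  · obtain rfl | ⟨w, h1, h2, h3⟩ := ha
    · exact absurd rfl hau
    · rcases eq_or_ne b u with rfl | hbu
      · exact Or.inl rfl
      · refine Or.inr ⟨w, h1, h2, mem_branch_of_adj h3 hab ?_⟩
        intro he
        rcases Sym2.eq_iff.1 he with ⟨h, -⟩ | ⟨-, h⟩
        · exact hau h
        · exact hbu h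

theorem branch_subset_branch {z u w : V} (hu : u ∉ branch G u w) (huw : G.Adj u w)
    (hwz : w ≠ z) : branch G u w ⊆ branch G z u := by
  apply branch_subset
  · apply mem_branch_of_adj (mem_branch_self z u) huw
    intro he
    rcases Sym2.eq_iff.1 he with ⟨h, h'⟩ | ⟨-, h⟩
    · exact huw.ne h'.symm
    · exact hwz h
  · intro x hx hx' y hxy hne
    have hxu : x ≠ u := by rintro rfl; exact hu hx'
    have hyu : y ≠ u := by
      rintro rfl
      exact hu (mem_branch_of_adj hx' hxy hne)
    apply mem_branch_of_adj hx hxy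
    intro he
    rcases Sym2.eq_iff.1 he with ⟨-, h⟩ | ⟨h, -⟩
    · exact hyu h
    · exact hxu h

theorem disjoint_branch {z u₁ u₂ : V} (h₁ : z ∉ branch G z u₁) (h₂ : z ∉ branch G z u₂)
    (ha₁ : G.Adj z u₁) (hne : u₁ ≠ u₂) : Disjoint (branch G z u₁) (branch G z u₂) := by
  rw [Set.disjoint_left]
  refine branch_subset (X := {x | x ∉ branch G z u₂}) ?_ ?_
  · intro h
    apply h₂
    apply mem_branch_of_adj h ha₁.symm
    intro he
    rcases Sym2.eq_iff.1 he with ⟨h, -⟩ | ⟨h, -⟩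
    · exact ha₁.ne h.symm
    · exact hne h
  · intro x hx hx' y hxy hne' hy
    have hxz : x ≠ z := by rintro rfl; exact h₁ hx'
    have hyz : y ≠ z := by rintro rfl; exact h₁ (mem_branch_of_adj hx' hxy hne')
    apply hx
    apply mem_branch_of_adj hy hxy.symm
    intro he
    rcases Sym2.eq_iff.1 he with ⟨h, -⟩ | ⟨-, h⟩
    · exact hyz h
    · exact hxz h

theorem dist_branch_out (hG : G.Connected) {z u s x : V} (hz : z ∉ branch G z u)
    (hs : s ∉ branch G z u) (hx : x ∈ branch G z u) :
    G.dist s x = G.dist s z + G.dist z x :=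
  dist_eq_add_of_cut hG hz (fun _ ha _ hb hab => (branch_boundary hz ha hb hab).2) hs hx

theorem dist_branch_root (hG : G.Connected) {z u x : V} (hzu : G.Adj z u)
    (hz : z ∉ branch G z u) (hx : x ∈ branch G z u) :
    G.dist z x = 1 + G.dist u x := by
  have h1 : G.dist z u = 1 := dist_eq_one_iff_adj.2 hzu
  rcases eq_or_ne x u with rfl | hxu
  · simp [h1]
  · rw [← h1]
    refine dist_eq_add_of_cut hG (X := branch G z u \ {u}) (by simp) ?_ (fun h => hz h.1)
      ⟨hx, by simpa using hxu⟩
    rintro a ⟨ha, hau⟩ b hb hab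
    by_contra hbu
    have hb' : b ∉ branch G z u := fun h => hb ⟨h, by simpa using hbu⟩
    exact hau (by simpa using (branch_boundary hz ha hb' hab).1)

theorem dist_lt_of_mem_branch (hG : G.Connected) {z u s x : V} (hzu : G.Adj z u)
    (hz : z ∉ branch G z u) (hs : s ∈ branch G z u) (hx : x ∈ branch G z u) :
    G.dist s x < G.dist s z + G.dist z x := by
  have h1 := dist_branch_root hG hzu hz hx
  have h2 := dist_branch_root hG hzu hz hs
  have h3 : G.dist s x ≤ G.dist s u + G.dist u x := hG.dist_triangle
  rw [dist_comm (u := s) (v := z), h2, h1]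
  rw [dist_comm (u := s) (v := u)] at h3
  omega

theorem eq_or_mem_branch_of_reachable {F : SimpleGraph V} (hFG : F ≤ G) {z x : V}
    (h : F.Reachable z x) : x = z ∨ ∃ u, F.Adj z u ∧ x ∈ branch G z u := by
  refine Reachable.mem_of_closed (X := {x | x = z ∨ ∃ u, F.Adj z u ∧ x ∈ branch G z u}) h
    (Or.inl rfl) ?_
  intro a ha b hab
  rcases eq_or_ne a z with rfl | haz
  · exact Or.inr ⟨b, hab, mem_branch_self _ _⟩
  · rcases eq_or_ne b z with rfl | hbz
    · exact Or.inl rfl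
    · obtain rfl | ⟨u, hu, hau⟩ := ha
      · exact absurd rfl haz
      · refine Or.inr ⟨u, hu, mem_branch_of_adj hau (hFG hab) ?_⟩
        intro he
        rcases Sym2.eq_iff.1 he with ⟨h, -⟩ | ⟨-, h⟩
        · exact haz h
        · exact hbz h

end Branch

section Tail

variable {V : Type*} [Fintype V] {G : SimpleGraph V} [DecidableRel G.Adj]

theorem three_le_degree {u a b c : V} (ha : G.Adj u a) (hb : G.Adj u b) (hc : G.Adj u c)
    (hab : a ≠ b) (hac : a ≠ c) (hbc : b ≠ c) : 3 ≤ G.degree u := by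
  classical
  rw [← card_neighborFinset_eq_degree]
  have : ({a, b, c} : Finset V) ⊆ G.neighborFinset u := by
    intro x hx
    simp only [Finset.mem_insert, Finset.mem_singleton] at hx
    rw [mem_neighborFinset]
    rcases hx with rfl | rfl | rfl <;> assumption
  calc 3 = ({a, b, c} : Finset V).card := (Finset.card_eq_three.2 ⟨a, b, c, hab, hac, hbc, rfl⟩).symm
    _ ≤ _ := Finset.card_le_card this

theorem eq_of_degree_eq_one {u a b : V} (hu : G.degree u = 1) (ha : G.Adj u a)
    (hb : G.Adj u b) : b = a := by
  obtain ⟨c, hc⟩ := Finset.card_eq_one.1 hu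
  have h1 : a ∈ G.neighborFinset u := (mem_neighborFinset _ _ _).2 ha
  have h2 : b ∈ G.neighborFinset u := (mem_neighborFinset _ _ _).2 hb
  rw [hc, Finset.mem_singleton] at h1 h2
  rw [h1, h2]

theorem eq_or_eq_of_degree_le_two {u a b c : V} (hu : G.degree u ≤ 2) (hab : a ≠ b)
    (ha : G.Adj u a) (hb : G.Adj u b) (hc : G.Adj u c) : c = a ∨ c = b := by
  by_contra! h
  have := three_le_degree ha hb hc hab h.1.symm h.2.symm
  omega

/-- `IsTail G z t` says that `t` is a path leaving `z` whose last vertex is a leaf and whose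
other vertices have degree two. -/
inductive IsTail (G : SimpleGraph V) [DecidableRel G.Adj] : V → List V → Prop
  | leaf {z u : V} : G.Adj z u → G.degree u = 1 → IsTail G z [u]
  | cons {z u : V} {t : List V} : G.Adj z u → G.degree u = 2 → z ∉ t → IsTail G u t →
      IsTail G z (u :: t)

namespace IsTail

variable {z : V} {t : List V}

theorem notMem (h : IsTail G z t) : z ∉ t := by
  cases h with
  | leaf h1 _ => simpa using h1.ne
  | cons h1 _ h3 _ => simp [h1.ne, h3]

theorem nodup (h : IsTail G z t) : t.Nodup := by
  induction h with
  | leaf => simp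
  | cons _ _ _ h4 ih => exact List.nodup_cons.2 ⟨h4.notMem, ih⟩

theorem exists_eq_cons (h : IsTail G z t) : ∃ u r, t = u :: r ∧ G.Adj z u := by
  cases h with
  | leaf h1 _ => exact ⟨_, _, rfl, h1⟩
  | cons h1 _ _ _ => exact ⟨_, _, rfl, h1⟩

theorem degree_le_two (h : IsTail G z t) {x : V} (hx : x ∈ t) : G.degree x ≤ 2 := by
  induction h with
  | leaf _ h2 => rw [List.mem_singleton.1 hx]; omega
  | cons _ h2 _ _ ih =>
    rcases List.mem_cons.1 hx with rfl | hx
    · omega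
    · exact ih hx

/-- Edges leaving a tail join its first vertex to its root. -/
theorem boundary (h : IsTail G z t) {a b : V} (ha : a ∈ t) (hb : b ∉ t) (hab : G.Adj a b) :
    b = z ∧ t.head? = some a := by
  induction h generalizing a b with
  | leaf h1 h2 =>
    obtain rfl := List.mem_singleton.1 ha
    exact ⟨eq_of_degree_eq_one h2 h1.symm hab, rfl⟩
  | @cons z u t h1 h2 h3 h4 ih =>
    rw [List.mem_cons, not_or] at hb
    rcases List.mem_cons.1 ha with rfl | ha
    · obtain ⟨w, r, rfl, hw⟩ := h4.exists_eq_cons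
      have hzw : z ≠ w := by rintro rfl; simp at h3
      rcases eq_or_eq_of_degree_le_two h2.le hzw h1.symm hw hab with rfl | rfl
      · exact ⟨rfl, rfl⟩
      · simp at hb
    · exact absurd (ih ha hb.2 hab).1 hb.1

theorem subset_of_closed (h : IsTail G z t) {X : Set V}
    (hX : ∀ a ∈ t, a ∈ X → ∀ b ∈ t, G.Adj a b → b ∈ X) {x : V} (hx : x ∈ t) (hxX : x ∈ X) :
    ∀ y ∈ t, y ∈ X := by
  have main : ∀ z t, IsTail G z t → (∀ a ∈ t, a ∈ X → ∀ b ∈ t, G.Adj a b → b ∈ X) →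
      (∃ x ∈ t, x ∈ X) → ∀ y ∈ t, y ∈ X := by
    intro z t h
    induction h with
    | leaf _ _ =>
      rintro - ⟨x, hx, hxX⟩ y hy
      rw [List.mem_singleton] at hx hy
      rwa [hy, ← hx]
    | @cons z u t h1 h2 h3 h4 ih =>
      rintro hX ⟨x, hx, hxX⟩
      have ih := ih fun a ha haX b hb hab =>
        hX a (List.mem_cons_of_mem _ ha) haX b (List.mem_cons_of_mem _ hb) hab
      obtain ⟨w, r, rfl, hw⟩ := h4.exists_eq_cons
      have hex : ∃ x ∈ w :: r, x ∈ X := by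
        rcases List.mem_cons.1 hx with rfl | hx
        · exact ⟨w, by simp, hX x (by simp) hxX w (by simp) hw⟩
        · exact ⟨x, hx, hxX⟩
      have hall := ih hex
      intro y hy
      rcases List.mem_cons.1 hy with rfl | hy
      · exact hX w (by simp) (hall w (by simp)) y (by simp) hw.symm
      · exact hall y hy
  exact main z t h hX ⟨x, hx, hxX⟩

theorem eq_of_cons {u : V} {r r' : List V} (h : IsTail G z (u :: r))
    (h' : IsTail G z (u :: r')) : r = r' := by
  induction r generalizing z u r' with
  | nil =>
    cases h with
    | leaf _ h2 =>
      cases h' with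
      | leaf => rfl
      | cons _ h2' => omega
    | cons _ _ _ h4 => cases h4
  | cons w r ih =>
    cases h with
    | cons h1 h2 h3 h4 =>
      cases h' with
      | leaf _ h2' => omega
      | cons _ _ h3' h4' =>
        obtain ⟨w', s, rfl, hw'⟩ := h4'.exists_eq_cons
        obtain ⟨w₁, s₁, he, hw⟩ := h4.exists_eq_cons
        simp only [List.cons.injEq] at he
        obtain ⟨rfl, rfl⟩ := he
        have hzw : z ≠ w := by rintro rfl; simp at h3
        rcases eq_or_eq_of_degree_le_two h2.le hzw h1.symm hw hw' with rfl | rfl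
        · simp at h3'
        · rw [ih h4 h4']

theorem dist_out (hG : G.Connected) (h : IsTail G z t) {s x : V} (hs : s ∉ t) (hx : x ∈ t) :
    G.dist s x = G.dist s z + G.dist z x :=
  dist_eq_add_of_cut hG (X := {x | x ∈ t}) h.notMem
    (fun _ ha _ hb hab => (h.boundary ha hb hab).1) hs hx

theorem exists_dist_eq (hG : G.Connected) (h : IsTail G z t) {m : ℕ} (h1 : 1 ≤ m)
    (hm : m ≤ t.length) : ∃ x ∈ t, G.dist z x = m := by
  induction h generalizing m with
  | leaf ha _ =>
    simp only [List.length_singleton] at hm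
    exact ⟨_, List.mem_singleton_self _, by rw [dist_eq_one_iff_adj.2 ha]; omega⟩
  | cons ha _ hz ht ih =>
    have hd := dist_eq_one_iff_adj.2 ha
    rcases h1.eq_or_lt with rfl | h1
    · exact ⟨_, List.mem_cons_self, hd⟩
    · simp only [List.length_cons] at hm
      obtain ⟨x, hx, hdx⟩ := @ih (m - 1) (by omega) (by omega)
      refine ⟨x, List.mem_cons_of_mem _ hx, ?_⟩
      rw [ht.dist_out hG hz hx, hd, hdx]
      omega

end IsTail

theorem isThreadAt_iff {v : V} {t : List V} :
    IsThreadAt G v t ↔ 3 ≤ G.degree v ∧ IsTail G v t := by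
  constructor
  · rintro ⟨h0, h1, h2, h3, h4, h5, h6, h7⟩
    refine ⟨h3, ?_⟩
    clear h3
    induction t generalizing v with
    | nil => exact absurd rfl h0
    | cons u t ih =>
      cases t with
      | nil => exact .leaf (h5 u rfl) (h6 u rfl)
      | cons w r =>
        have hc := List.isChain_cons_cons.1 h4
        refine .cons (h5 u rfl) (h7 u (by simp)) (fun h => h2 (List.mem_cons_of_mem _ h)) ?_
        refine ih (by simp) (List.nodup_cons.1 h1).2 (List.nodup_cons.1 h1).1 hc.2 ?_ ?_ ?_
        · intro x hx
          simp only [List.head?_cons, Option.mem_def, Option.some.injEq] at hx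
          exact hx ▸ hc.1
        · intro x hx
          exact h6 x (by simpa [List.getLast?_cons_cons] using hx)
        · intro x hx
          exact h7 x (by simp [List.dropLast_cons_cons, hx])
  · rintro ⟨h3, h⟩
    have hcl : List.IsChain G.Adj t ∧ (∀ u ∈ t.head?, G.Adj v u) ∧
        (∀ u ∈ t.getLast?, G.degree u = 1) ∧ ∀ u ∈ t.dropLast, G.degree u = 2 := by
      clear h3
      induction h with
      | leaf h1 h2 => simp [h1, h2]
      | cons h1 h2 _ h4 ih =>
        obtain ⟨w, r, rfl, hw⟩ := h4.exists_eq_cons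
        obtain ⟨i1, i2, i3, i4⟩ := ih
        refine ⟨List.isChain_cons_cons.2 ⟨hw, i1⟩, by simpa using h1, ?_, ?_⟩
        · intro x hx
          exact i3 x (by simpa [List.getLast?_cons_cons] using hx)
        · intro x hx
          rw [List.dropLast_cons_cons, List.mem_cons] at hx
          rcases hx with rfl | hx
          · exact h2
          · exact i4 x hx
    refine ⟨?_, h.nodup, h.notMem, h3, hcl⟩
    rintro rfl
    cases h

theorem IsThreadAt.isTail {v : V} {t : List V} (h : IsThreadAt G v t) : IsTail G v t :=
  (isThreadAt_iff.1 h).2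

theorem IsThreadAt.notMem_of_isTail {v : V} {t : List V} (h : IsThreadAt G v t) {z : V}
    {r : List V} (hr : IsTail G z r) : v ∉ r := by
  intro hv
  have h1 := hr.degree_le_two hv
  have h2 := (isThreadAt_iff.1 h).1
  omega

/-- Two threads sharing a vertex coincide and hang at the same vertex. -/
theorem IsThreadAt.eq_of_common {v v' x : V} {t t' : List V} (h : IsThreadAt G v t)
    (h' : IsThreadAt G v' t') (hx : x ∈ t) (hx' : x ∈ t') : v = v' ∧ t = t' := by
  have sub : ∀ {v v' : V} {t t' : List V}, IsThreadAt G v t → IsThreadAt G v' t' → x ∈ t →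
      x ∈ t' → ∀ y ∈ t, y ∈ t' := by
    intro v v' t t' h h' hx hx'
    refine h.isTail.subset_of_closed (X := {y | y ∈ t'}) ?_ hx hx'
    intro a _ ha' b hb hab
    by_contra hb'
    exact h'.notMem_of_isTail h.isTail ((h'.isTail.boundary ha' hb' hab).1 ▸ hb)
  have s1 := sub h h' hx hx'
  obtain ⟨u, r, rfl, hu⟩ := h.isTail.exists_eq_cons
  obtain ⟨e1, e2⟩ := h'.isTail.boundary (s1 u (by simp))
    (h.notMem_of_isTail h'.isTail) hu.symm
  subst e1
  obtain ⟨u', r', rfl, hu'⟩ := h'.isTail.exists_eq_cons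
  simp only [List.head?_cons, Option.some.injEq] at e2
  subst e2
  exact ⟨rfl, by rw [h.isTail.eq_of_cons h'.isTail]⟩

theorem finite_threads (v : V) : {t : List V | IsThreadAt G v t}.Finite :=
  have : Finite {t : List V | t.Nodup} := by
    classical exact inferInstanceAs (Finite {t : List V // t.Nodup})
  (Set.toFinite {t : List V | t.Nodup}).subset fun _ h => h.isTail.nodup

/-- The threads hanging at `v`. -/
noncomputable def threads (G : SimpleGraph V) [DecidableRel G.Adj] (v : V) :
    Finset (List V) := (finite_threads (G := G) v).toFinset

@[simp]
theorem mem_threads {v : V} {t : List V} : t ∈ threads G v ↔ IsThreadAt G v t := by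
  simp [threads]

theorem numThreads_eq (v : V) : numThreads G v = (threads G v).card :=
  Set.ncard_eq_toFinset_card _ _

theorem LG_le_card {S : Finset V} (hS : BranchResolving G ↑S) : LG G ≤ S.card := by
  classical
  let hit : V → Finset V := fun v => S.filter fun s => ∃ t, IsThreadAt G v t ∧ s ∈ t
  have h1 : ∀ v, numThreads G v - 1 ≤ (hit v).card := by
    intro v
    rw [numThreads_eq]
    let T := (threads G v).filter fun t => ∃ s ∈ S, s ∈ t
    have hT : (threads G v).card - 1 ≤ T.card := by
      have hsplit := Finset.card_filter_add_card_filter_not (s := threads G v)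
        (fun t => ∃ s ∈ S, s ∈ t)
      have hle : ((threads G v).filter fun t => ¬ ∃ s ∈ S, s ∈ t).card ≤ 1 := by
        rw [Finset.card_le_one]
        intro a ha b hb
        simp only [Finset.mem_filter, mem_threads] at ha hb
        by_contra hab
        rcases hS v a b ha.1 hb.1 hab with h | h
        · exact ha.2 (by simpa using h)
        · exact hb.2 (by simpa using h)
      change _ ≤ ((threads G v).filter fun t => ∃ s ∈ S, s ∈ t).card
      omega
    refine hT.trans ?_
    have hmem : ∀ t, ∃ s, t ∈ T → s ∈ S ∧ s ∈ t := by
      intro t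
      by_cases ht : t ∈ T
      · obtain ⟨s, h⟩ := (Finset.mem_filter.1 ht).2
        exact ⟨s, fun _ => h⟩
      · exact ⟨v, fun h => absurd h ht⟩
    have hth : ∀ t ∈ T, IsThreadAt G v t := fun t ht =>
      mem_threads.1 (Finset.mem_filter.1 ht).1
    choose f hf using hmem
    refine Finset.card_le_card_of_injOn f ?_ ?_
    · intro t ht
      exact Finset.mem_coe.2 (Finset.mem_filter.2 ⟨(hf t ht).1, t, hth t ht, (hf t ht).2⟩)
    · intro a ha b hb hab
      exact ((hth a ha).eq_of_common (hth b hb) (hf a ha).2 (hab ▸ (hf b hb).2)).2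
  calc LG G ≤ ∑ v, (hit v).card := Finset.sum_le_sum fun v _ => h1 v
    _ = (Finset.univ.biUnion hit).card := by
      rw [Finset.card_biUnion]
      intro v _ w _ hvw
      rw [Function.onFun, Finset.disjoint_left]
      intro s hs hs'
      obtain ⟨-, t, ht, hst⟩ := Finset.mem_filter.1 hs
      obtain ⟨-, t', ht', hst'⟩ := Finset.mem_filter.1 hs'
      exact hvw (ht.eq_of_common ht' hst hst').1
    _ ≤ S.card := Finset.card_le_card (Finset.biUnion_subset.2 fun v _ => Finset.filter_subset _ _)

theorem exists_branchResolving_card_le :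
    ∃ S : Finset V, BranchResolving G ↑S ∧ S.card ≤ LG G := by
  classical
  have hch : ∀ v, ∃ T ⊆ threads G v, T.card ≤ numThreads G v - 1 ∧
      ∀ t ∈ threads G v, ∀ t' ∈ threads G v, t ≠ t' → t ∈ T ∨ t' ∈ T := by
    intro v
    rw [numThreads_eq]
    rcases (threads G v).eq_empty_or_nonempty with h | ⟨t₀, h⟩
    · exact ⟨∅, by simp, by simp, by simp [h]⟩
    · refine ⟨(threads G v).erase t₀, Finset.erase_subset _ _,
        (Finset.card_erase_of_mem h).le, ?_⟩
      intro t ht t' ht' hne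
      by_cases h' : t = t₀
      · exact Or.inr (Finset.mem_erase.2 ⟨fun h => hne (h'.trans h.symm), ht'⟩)
      · exact Or.inl (Finset.mem_erase.2 ⟨h', ht⟩)
  choose T hT1 hT2 hT3 using hch
  refine ⟨Finset.univ.biUnion fun v => (T v).biUnion fun t => t.head?.toFinset, ?_, ?_⟩
  · have key : ∀ v t, t ∈ T v → ∃ s ∈ (↑(Finset.univ.biUnion fun v => (T v).biUnion
        fun t => t.head?.toFinset) : Set V), s ∈ t := by
      intro v t ht
      obtain ⟨u, r, rfl, -⟩ := (mem_threads.1 (hT1 v ht)).isTail.exists_eq_cons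
      refine ⟨u, ?_, by simp⟩
      simp only [Finset.coe_biUnion, Set.mem_iUnion]
      exact ⟨v, by simp, u :: r, ht, by simp⟩
    intro v t₁ t₂ h₁ h₂ hne
    rcases hT3 v t₁ (mem_threads.2 h₁) t₂ (mem_threads.2 h₂) hne with h | h
    · exact Or.inl (key v t₁ h)
    · exact Or.inr (key v t₂ h)
  · refine Finset.card_biUnion_le.trans (Finset.sum_le_sum fun v _ => ?_)
    refine (Finset.card_biUnion_le.trans ?_).trans (hT2 v)
    refine (Finset.sum_le_card_nsmul _ _ 1 fun t _ => ?_).trans (by simp)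
    cases t.head? <;> simp

theorem SmallestBR.card_eq {S : Finset V} (hS : SmallestBR G S) : S.card = LG G := by
  obtain ⟨S', h1, h2⟩ := exists_branchResolving_card_le (G := G)
  exact le_antisymm ((hS.2 S' h1).trans h2) (LG_le_card hS.1)

theorem SmallestBR.exists_threads {S : Finset V} (hS : SmallestBR G S) {s : V} (hs : s ∈ S) :
    ∃ v t t', IsThreadAt G v t ∧ IsThreadAt G v t' ∧ t ≠ t' ∧ s ∈ t := by
  classical
  by_contra! hcon
  have hbr : BranchResolving G ↑(S.erase s) := by
    intro v t₁ t₂ h₁ h₂ hne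
    have n1 : s ∉ t₁ := hcon v t₁ t₂ h₁ h₂ hne
    have n2 : s ∉ t₂ := hcon v t₂ t₁ h₂ h₁ hne.symm
    refine (hS.1 v t₁ t₂ h₁ h₂ hne).imp ?_ ?_
    · rintro ⟨x, hx, hxt⟩
      exact ⟨x, Finset.mem_coe.2 (Finset.mem_erase.2 ⟨fun h => n1 (h ▸ hxt), hx⟩), hxt⟩
    · rintro ⟨x, hx, hxt⟩
      exact ⟨x, Finset.mem_coe.2 (Finset.mem_erase.2 ⟨fun h => n2 (h ▸ hxt), hx⟩), hxt⟩
  have h1 := hS.2 _ hbr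
  have h2 := Finset.card_erase_lt_of_mem hs
  omega

theorem SmallestBR.exists_sFree {S : Finset V} (hS : SmallestBR G S) {v : V} {t : List V}
    (ht : IsThreadAt G v t) : ∃ t', IsThreadAt G v t' ∧ SFree (↑S : Set V) t' := by
  classical
  by_contra! hcon
  have hhit : ∀ t, IsThreadAt G v t → ∃ s ∈ S, s ∈ t := by
    intro t ht
    have := hcon t ht
    unfold SFree at this
    push Not at this
    obtain ⟨s, h1, h2⟩ := this
    exact ⟨s, h2, h1⟩
  obtain ⟨s, hs, hst⟩ := hhit t ht
  have hbr : BranchResolving G ↑(S.erase s) := by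
    intro w t₁ t₂ h₁ h₂ hne
    have aux : ∀ {t'}, IsThreadAt G w t' → t' ≠ t → (∃ x ∈ (↑S : Set V), x ∈ t') →
        ∃ x ∈ (↑(S.erase s) : Set V), x ∈ t' := by
      rintro t' ht' hne' ⟨x, hx, hxt⟩
      refine ⟨x, Finset.mem_coe.2 (Finset.mem_erase.2 ⟨?_, hx⟩), hxt⟩
      rintro rfl
      exact hne' (ht'.eq_of_common ht hxt hst).2
    by_cases e1 : t₁ = t
    · subst e1
      have hvw := (h₁.eq_of_common ht hst hst).1
      subst hvw
      exact Or.inr (aux h₂ hne.symm (hhit t₂ h₂))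
    · by_cases e2 : t₂ = t
      · subst e2
        have hvw := (h₂.eq_of_common ht hst hst).1
        subst hvw
        exact Or.inl (aux h₁ hne (hhit t₁ h₁))
      · exact (hS.1 w t₁ t₂ h₁ h₂ hne).imp (aux h₁ e1) (aux h₂ e2)
  have h1 := hS.2 _ hbr
  have h2 := Finset.card_erase_lt_of_mem hs
  omega

theorem IsVertexMG.branchResolving (hG : G.Connected) {S : Set V} (hS : IsVertexMG G S) :
    BranchResolving G S := by
  intro v t₁ t₂ h₁ h₂ hne
  by_contra! hcon
  obtain ⟨u₁, r₁, rfl, a₁⟩ := h₁.isTail.exists_eq_cons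
  obtain ⟨u₂, r₂, rfl, a₂⟩ := h₂.isTail.exists_eq_cons
  have hu : u₁ ≠ u₂ := by
    rintro rfl
    exact hne (by rw [h₁.isTail.eq_of_cons h₂.isTail])
  obtain ⟨s, hs, hd⟩ := hS u₁ u₂ hu
  apply hd
  rw [h₁.isTail.dist_out hG (hcon.1 s hs) (x := u₁) (by simp),
    h₂.isTail.dist_out hG (hcon.2 s hs) (x := u₂) (by simp), dist_eq_one_iff_adj.2 a₁, dist_eq_one_iff_adj.2 a₂]

end Tail

section Cycle

/-- The distance between the positions `a` and `b` on a cycle of length `g`. -/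
def cyc (g a b : ℕ) : ℕ := min ((a - b) + (b - a)) (g - ((a - b) + (b - a)))

theorem ZMod.natCast_inj_of_lt {g m n : ℕ} (hm : m < g) (hn : n < g)
    (h : (m : ZMod g) = n) : m = n := by
  have := congrArg ZMod.val h
  rwa [ZMod.val_natCast_of_lt hm, ZMod.val_natCast_of_lt hn] at this

theorem ZMod.val_add_one_cases {g : ℕ} [NeZero g] (c : ZMod g) :
    (c.val + 1 < g ∧ (c + 1).val = c.val + 1) ∨ (c.val + 1 = g ∧ (c + 1).val = 0) := by
  have hc : c + 1 = ((c.val + 1 : ℕ) : ZMod g) := by simp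
  have hlt := ZMod.val_lt c
  rcases Nat.lt_or_ge (c.val + 1) g with h | h
  · exact Or.inl ⟨h, by rw [hc, ZMod.val_natCast_of_lt h]⟩
  · have h' : c.val + 1 = g := by omega
    exact Or.inr ⟨h', by rw [hc, h']; simp⟩

theorem cyc_le_succ {g : ℕ} [NeZero g] (c b : ZMod g) :
    cyc g c.val b.val ≤ cyc g (c + 1).val b.val + 1 ∧
    cyc g (c + 1).val b.val ≤ cyc g c.val b.val + 1 := by
  have h1 := ZMod.val_lt c
  have h2 := ZMod.val_lt b
  unfold cyc
  rcases ZMod.val_add_one_cases c with ⟨h, h'⟩ | ⟨h, h'⟩ <;> rw [h'] <;> omega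

variable {V : Type*} {G : SimpleGraph V} {g : ℕ} {vc : ZMod g → V}

theorem IsCycleLabelling.exists_cycle (hg : 3 ≤ g) (hvc : IsCycleLabelling G g vc) :
    ∃ (u : V) (w : G.Walk u u), w.IsCycle ∧ ∀ e, e ∈ w.edges ↔ e ∈ cycleEdges g vc := by
  have hpath : ∀ n : ℕ, n < g → ∃ p : G.Walk (vc (n : ZMod g)) (vc ((0 : ℕ) : ZMod g)),
      p.IsPath ∧ (∀ x ∈ p.support, ∃ m ≤ n, x = vc (m : ZMod g)) ∧
      ∀ e, e ∈ p.edges ↔ ∃ m < n, e = s(vc (m : ZMod g), vc ((m : ZMod g) + 1)) := by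
    intro n
    induction n with
    | zero => exact fun _ => ⟨.nil, by simp, by simp, by simp⟩
    | succ n ih =>
      intro hn
      obtain ⟨p, h1, h2, h3⟩ := ih (by omega)
      have hadj : G.Adj (vc ((n + 1 : ℕ) : ZMod g)) (vc (n : ZMod g)) := by
        have := hvc.2 (n : ZMod g)
        push_cast
        exact this.symm
      refine ⟨.cons hadj p, ?_, ?_, ?_⟩
      · rw [Walk.cons_isPath_iff]
        refine ⟨h1, fun h => ?_⟩
        obtain ⟨m, hm, he⟩ := h2 _ h
        have := ZMod.natCast_inj_of_lt hn (by omega) (hvc.1 he)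
        omega
      · intro x hx
        rw [Walk.support_cons, List.mem_cons] at hx
        rcases hx with rfl | hx
        · exact ⟨n + 1, le_rfl, rfl⟩
        · obtain ⟨m, hm, he⟩ := h2 x hx
          exact ⟨m, by omega, he⟩
      · intro e
        rw [Walk.edges_cons, List.mem_cons, h3]
        constructor
        · rintro (rfl | ⟨m, hm, rfl⟩)
          · exact ⟨n, by omega, by push_cast; exact Sym2.eq_swap⟩
          · exact ⟨m, by omega, rfl⟩
        · rintro ⟨m, hm, rfl⟩
          rcases Nat.lt_succ_iff_lt_or_eq.1 hm with h | rfl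
          · exact Or.inr ⟨m, h, rfl⟩
          · left
            push_cast
            exact Sym2.eq_swap
  obtain ⟨p, h1, -, h3⟩ := hpath (g - 1) (by omega)
  have hg1 : ((g - 1 : ℕ) : ZMod g) + 1 = ((0 : ℕ) : ZMod g) := by
    have : ((g - 1 + 1 : ℕ) : ZMod g) = 0 := by
      rw [Nat.sub_add_cancel (by omega)]; simp
    push_cast at this
    simpa using this
  have hadj : G.Adj (vc ((0 : ℕ) : ZMod g)) (vc ((g - 1 : ℕ) : ZMod g)) := by
    have := hvc.2 ((g - 1 : ℕ) : ZMod g)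
    rw [hg1] at this
    exact this.symm
  refine ⟨_, .cons hadj p, ?_, ?_⟩
  · rw [Walk.cons_isCycle_iff]
    refine ⟨h1, fun h => ?_⟩
    obtain ⟨m, hm, he⟩ := (h3 _).1 h
    have hm1 : (m : ZMod g) + 1 = ((m + 1 : ℕ) : ZMod g) := by push_cast; rfl
    rw [hm1] at he
    rcases Sym2.eq_iff.1 he with ⟨e1, e2⟩ | ⟨e1, -⟩
    · have := ZMod.natCast_inj_of_lt (by omega) (by omega) (hvc.1 e1)
      have := ZMod.natCast_inj_of_lt (by omega) (by omega) (hvc.1 e2)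
      omega
    · have := ZMod.natCast_inj_of_lt (by omega) (by omega) (hvc.1 e1)
      omega
  · intro e
    have : NeZero g := ⟨by omega⟩
    rw [Walk.edges_cons, List.mem_cons, h3]
    constructor
    · rintro (rfl | ⟨m, -, rfl⟩)
      · exact ⟨((g - 1 : ℕ) : ZMod g), by rw [hg1]; exact Sym2.eq_swap⟩
      · exact ⟨m, rfl⟩
    · rintro ⟨i, rfl⟩
      have hi := ZMod.val_lt i
      rcases Nat.lt_or_ge i.val (g - 1) with h | h
      · exact Or.inr ⟨i.val, h, by simp⟩
      · left
        have : i = ((g - 1 : ℕ) : ZMod g) := by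
          rw [show g - 1 = i.val by omega]; simp
        rw [this, hg1]
        exact Sym2.eq_swap

theorem IsUnicyclic.mem_edges_iff (hU : IsUnicyclic G) (hg : 3 ≤ g)
    (hvc : IsCycleLabelling G g vc) {u : V} {w : G.Walk u u} (hw : w.IsCycle) (e : Sym2 V) :
    e ∈ w.edges ↔ e ∈ cycleEdges g vc := by
  obtain ⟨u', w', h1, h2⟩ := hvc.exists_cycle hg
  rw [hU.2.2 u u' w w' hw h1 e, h2]

theorem offCycle_le : offCycle G g vc ≤ G := deleteEdges_le _

theorem offCycle_adj_iff {a b : V} :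
    (offCycle G g vc).Adj a b ↔ G.Adj a b ∧ s(a, b) ∉ cycleEdges g vc := deleteEdges_adj

theorem offCycle_adj_of_notMem {a b : V} (h : G.Adj a b) (ha : ∀ i, vc i ≠ a) :
    (offCycle G g vc).Adj a b := by
  refine offCycle_adj_iff.2 ⟨h, ?_⟩
  rintro ⟨i, hi⟩
  rcases Sym2.eq_iff.1 hi with ⟨h, -⟩ | ⟨h, -⟩
  · exact ha _ h.symm
  · exact ha _ h.symm

section Structure

variable (hU : IsUnicyclic G) (hg : 3 ≤ g) (hvc : IsCycleLabelling G g vc)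
include hU hg hvc

theorem root_notMem_branch {z u : V} (h : (offCycle G g vc).Adj z u) : z ∉ branch G z u := by
  have h' := offCycle_adj_iff.1 h
  have hb : G.IsBridge s(z, u) :=
    (isBridge_iff_forall_cycle_notMem h'.1).2 fun v p hp hmem =>
      h'.2 ((hU.mem_edges_iff hg hvc hp _).1 hmem)
  intro hz
  exact isBridge_iff.1 hb (Reachable.symm hz)

omit hU in
theorem cycle_mem_branch {z u : V} (h : (offCycle G g vc).Adj z u) {j : ZMod g}
    (hj : vc j ∈ branch G z u) (l : ZMod g) : vc l ∈ branch G z u := by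
  have : NeZero g := ⟨by omega⟩
  have key : ∀ n : ℕ, vc (j + n) ∈ branch G z u := by
    intro n
    induction n with
    | zero => simpa using hj
    | succ n ih =>
      have hadj := hvc.2 (j + n)
      have he : j + ((n + 1 : ℕ) : ZMod g) = j + n + 1 := by push_cast; ring
      rw [he]
      exact mem_branch_of_adj ih hadj fun h' => (offCycle_adj_iff.1 h).2 ⟨_, h'.symm⟩
  have := key (l - j).val
  rwa [ZMod.natCast_zmod_val, add_sub_cancel] at this

theorem cycle_notMem_branch {i : ZMod g} {u : V} (h : (offCycle G g vc).Adj (vc i) u)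
    (j : ZMod g) : vc j ∉ branch G (vc i) u := fun hj =>
  root_notMem_branch hU hg hvc h (cycle_mem_branch hg hvc h hj i)

theorem inTree_cycle {i j : ZMod g} (h : inTree G g vc i (vc j)) : i = j := by
  rcases eq_or_mem_branch_of_reachable offCycle_le h with h | ⟨u, hu, hj⟩
  · exact (hvc.1 h).symm
  · exact absurd hj (cycle_notMem_branch hU hg hvc hu j)

theorem inTree_unique {i j : ZMod g} {x : V} (hi : inTree G g vc i x)
    (hj : inTree G g vc j x) : i = j :=
  inTree_cycle hU hg hvc (Reachable.trans hi (Reachable.symm hj))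

omit hg hvc in
theorem exists_inTree (x : V) : ∃ i, inTree G g vc i x := by
  refine (hU.1.preconnected (vc 0) x).mem_of_closed (X := {x | ∃ i, inTree G g vc i x})
    ⟨0, Reachable.refl _⟩ ?_
  rintro a ⟨i, hi⟩ b hab
  by_cases h : s(a, b) ∈ cycleEdges g vc
  · obtain ⟨j, hj⟩ := h
    have hb : b = vc j ∨ b = vc (j + 1) := by
      rcases Sym2.eq_iff.1 hj with ⟨-, h⟩ | ⟨-, h⟩
      · exact Or.inr h
      · exact Or.inl h
    rcases hb with rfl | rfl <;> exact ⟨_, Reachable.refl _⟩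
  · exact ⟨i, Reachable.trans hi (offCycle_adj_iff.2 ⟨hab, h⟩).reachable⟩

theorem inTree_of_mem_branch {i : ZMod g} {u x : V} (h : (offCycle G g vc).Adj (vc i) u)
    (hx : x ∈ branch G (vc i) u) : inTree G g vc i x := by
  refine branch_subset (X := {x | inTree G g vc i x}) h.reachable ?_ hx
  intro a ha hab b hadj _
  refine Reachable.trans ha (offCycle_adj_of_notMem hadj ?_).reachable
  rintro j rfl
  exact cycle_notMem_branch hU hg hvc h j hab

theorem dist_out_of_inTree {i : ZMod g} {s x : V} (hs : ¬ inTree G g vc i s)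
    (hx : inTree G g vc i x) : G.dist s x = G.dist s (vc i) + G.dist (vc i) x := by
  rcases eq_or_ne x (vc i) with rfl | hne
  · simp
  refine dist_eq_add_of_cut hU.1 (X := {x | inTree G g vc i x} \ {vc i}) (by simp) ?_
    (fun h => hs h.1) ⟨hx, by simpa using hne⟩
  rintro a ⟨ha, hai⟩ b hb hab
  by_contra hbi
  refine hb ⟨Reachable.trans ha (offCycle_adj_of_notMem hab ?_).reachable, by simpa using hbi⟩
  rintro j rfl
  exact hai (by simp [inTree_cycle hU hg hvc ha])

theorem dist_of_inTree_ne {i j : ZMod g} (hij : i ≠ j) {s x : V} (hs : inTree G g vc i s)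
    (hx : inTree G g vc j x) :
    G.dist s x = G.dist s (vc i) + G.dist (vc i) (vc j) + G.dist (vc j) x := by
  rw [dist_out_of_inTree hU hg hvc (fun h => hij (inTree_unique hU hg hvc hs h)) hx,
    dist_comm (u := s) (v := vc j),
    dist_out_of_inTree hU hg hvc (s := vc j)
      (fun h => hij (inTree_cycle hU hg hvc h)) hs,
    dist_comm (u := vc j) (v := vc i), dist_comm (u := vc i) (v := s)]
  ring

theorem dist_cycle (a b : ZMod g) : G.dist (vc a) (vc b) = cyc g a.val b.val := by
  have : NeZero g := ⟨by omega⟩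
  apply le_antisymm
  · have h1 : ∀ (c : ZMod g) (n : ℕ), G.dist (vc c) (vc (c + n)) ≤ n := by
      intro c n
      induction n with
      | zero => simp
      | succ n ih =>
        have he : c + ((n + 1 : ℕ) : ZMod g) = c + n + 1 := by push_cast; ring
        have h2 := dist_eq_one_iff_adj.2 (hvc.2 (c + n))
        have h3 : G.dist (vc c) (vc (c + n + 1)) ≤
          G.dist (vc c) (vc (c + n)) + G.dist (vc (c + n)) (vc (c + n + 1)) := hU.1.dist_triangle
        rw [he]
        omega
    have h2 : ∀ a b : ZMod g, a.val ≤ b.val → G.dist (vc a) (vc b) ≤ cyc g a.val b.val := by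
      intro a b hab
      have ha := ZMod.val_lt a
      have hb := ZMod.val_lt b
      have e1 : a + ((b.val - a.val : ℕ) : ZMod g) = b := by
        rw [Nat.cast_sub hab]; simp
      have e2 : b + ((g - (b.val - a.val) : ℕ) : ZMod g) = a := by
        rw [Nat.cast_sub (by omega), Nat.cast_sub hab]; simp
      have h3 := h1 a (b.val - a.val)
      have h4 := h1 b (g - (b.val - a.val))
      rw [e1] at h3
      rw [e2, dist_comm] at h4
      unfold cyc
      omega
    rcases le_total a.val b.val with h | h
    · exact h2 a b h
    · have := h2 b a h
      rw [dist_comm]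
      unfold cyc at *
      omega
  · have key : ∀ (x y : V) (p : G.Walk x y) (i : ZMod g), inTree G g vc i x →
        inTree G g vc b y → cyc g i.val b.val ≤ p.length := by
      intro x y p
      induction p with
      | nil =>
        intro i h1 h2
        rw [inTree_unique hU hg hvc h1 h2]
        simp [cyc]
      | @cons x x' y hadj p ih =>
        intro i h1 h2
        rw [Walk.length_cons]
        by_cases h : s(x, x') ∈ cycleEdges g vc
        · obtain ⟨j, hj⟩ := h
          have h3 := cyc_le_succ j b
          rcases Sym2.eq_iff.1 hj with ⟨rfl, rfl⟩ | ⟨rfl, rfl⟩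
          · rw [inTree_cycle hU hg hvc h1]
            have := ih (j + 1) (Reachable.refl _) h2
            omega
          · rw [inTree_cycle hU hg hvc h1]
            have := ih j (Reachable.refl _) h2
            omega
        · have := ih i (Reachable.trans h1 (offCycle_adj_iff.2 ⟨hadj, h⟩).reachable) h2
          omega
    obtain ⟨p, hp⟩ := hU.1.exists_walk_length_eq_dist (vc a) (vc b)
    rw [← hp]
    exact key _ _ p a (Reachable.refl _) (Reachable.refl _)

end Structure

theorem cycleEdges_eq (hU : IsUnicyclic G) (hg : 3 ≤ g) (hvc : IsCycleLabelling G g vc)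
    {vc' : ZMod g → V} (hvc' : IsCycleLabelling G g vc') :
    cycleEdges g vc = cycleEdges g vc' := by
  obtain ⟨u, w, h1, -⟩ := hvc.exists_cycle hg
  ext e
  rw [← hU.mem_edges_iff hg hvc h1, ← hU.mem_edges_iff hg hvc' h1]

theorem SActive.transfer (hU : IsUnicyclic G) (hg : 3 ≤ g) (hvc : IsCycleLabelling G g vc)
    {vc' : ZMod g → V} (hvc' : IsCycleLabelling G g vc') {S : Set V} {i : ZMod g}
    (h : SActive G g vc S i) : ∃ j, vc' j = vc i ∧ SActive G g vc' S j := by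
  have he := cycleEdges_eq hU hg hvc hvc'
  have hmem : s(vc i, vc (i + 1)) ∈ cycleEdges g vc' := he ▸ ⟨i, rfl⟩
  have hj : ∃ j, vc' j = vc i := by
    obtain ⟨j, hj⟩ := hmem
    rcases Sym2.eq_iff.1 hj with ⟨h, -⟩ | ⟨h, -⟩
    · exact ⟨_, h.symm⟩
    · exact ⟨_, h.symm⟩
  obtain ⟨j, hj⟩ := hj
  obtain ⟨s, hs, hsi⟩ := h
  refine ⟨j, hj, s, hs, ?_⟩
  unfold inTree offCycle at *
  rwa [hj, ← he]

end Cycle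

section Resolving

variable {V : Type*} [Fintype V] {G : SimpleGraph V} [DecidableRel G.Adj] {g : ℕ}
  {vc : ZMod g → V} (hU : IsUnicyclic G) (hg : 3 ≤ g) (hvc : IsCycleLabelling G g vc)
include hU hg hvc

/-- A branch off the cycle is a tail, or contains two threads hanging at a common vertex. -/
theorem isTail_or_exists_threads (n : ℕ) : ∀ z u : V, (branch G z u).ncard ≤ n →
    (offCycle G g vc).Adj z u → (∀ j, vc j ∉ branch G z u) →
    (∃ t, IsTail G z t ∧ (∀ x, x ∈ t ↔ x ∈ branch G z u) ∧
      ∀ x ∈ t, G.dist z x ≤ t.length) ∨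
    ∃ w t₁ t₂, t₁ ≠ t₂ ∧ IsThreadAt G w t₁ ∧ IsThreadAt G w t₂ ∧
      (∀ x ∈ t₁, x ∈ branch G z u) ∧ ∀ x ∈ t₂, x ∈ branch G z u := by
  induction n with
  | zero =>
    intro z u hn
    have := (Set.ncard_pos (Set.toFinite _)).2 ⟨u, mem_branch_self (G := G) z u⟩
    omega
  | succ n ih =>
    intro z u hn hzu hcyc
    have hG := hU.1
    have hzuG : G.Adj z u := offCycle_le hzu
    have hz := root_notMem_branch hU hg hvc hzu
    have hu : ∀ j, vc j ≠ u := by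
      rintro j rfl
      exact hcyc j (mem_branch_self z _)
    have hoff : ∀ w, G.Adj u w → (offCycle G g vc).Adj u w := fun w h =>
      offCycle_adj_of_notMem h hu
    have hsub : ∀ w, G.Adj u w → w ≠ z → branch G u w ⊆ branch G z u := fun w h hne =>
      branch_subset_branch (root_notMem_branch hU hg hvc (hoff w h)) h hne
    have hrec : ∀ w, G.Adj u w → w ≠ z → _ := fun w h hne => ih u w (by
      have : branch G u w ⊂ branch G z u := (Set.ssubset_iff_of_subset (hsub w h hne)).2
        ⟨u, mem_branch_self z u, root_notMem_branch hU hg hvc (hoff w h)⟩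
      have := Set.ncard_lt_ncard this (Set.toFinite _)
      omega) (hoff w h) (fun j hj => hcyc j (hsub w h hne hj))
    by_cases h0 : ∀ w, G.Adj u w → w = z
    · left
      have hd : G.degree u = 1 := by
        rw [← card_neighborFinset_eq_degree, Finset.card_eq_one]
        refine ⟨z, ?_⟩
        ext w
        rw [mem_neighborFinset, Finset.mem_singleton]
        exact ⟨h0 w, fun h => h ▸ hzuG.symm⟩
      refine ⟨[u], .leaf hzuG hd, ?_, ?_⟩
      · intro x
        rw [List.mem_singleton]
        refine ⟨by rintro rfl; exact mem_branch_self z _, fun h => ?_⟩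
        rcases eq_or_mem_branch h with h | ⟨w, h1, h2, -⟩
        · exact h
        · exact absurd (h0 w h1) h2
      · intro x hx
        rw [List.mem_singleton.1 hx, dist_eq_one_iff_adj.2 hzuG]
        simp
    · push Not at h0
      obtain ⟨w₁, hw₁, hne₁⟩ := h0
      rcases hrec w₁ hw₁ hne₁ with ⟨t₁, ht₁, hm₁, hl₁⟩ | ⟨w, a, b, h1, h2, h3, h4, h5⟩
      swap
      · exact Or.inr ⟨w, a, b, h1, h2, h3, fun x hx => hsub _ hw₁ hne₁ (h4 x hx),
          fun x hx => hsub _ hw₁ hne₁ (h5 x hx)⟩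
      by_cases h1 : ∀ w, G.Adj u w → w ≠ z → w = w₁
      · left
        have hd : G.degree u = 2 := by
          classical
          rw [← card_neighborFinset_eq_degree, Finset.card_eq_two]
          refine ⟨z, w₁, hne₁.symm, ?_⟩
          ext w
          simp only [mem_neighborFinset, Finset.mem_insert, Finset.mem_singleton]
          refine ⟨fun h => or_iff_not_imp_left.2 (h1 w h), ?_⟩
          rintro (rfl | rfl)
          · exact hzuG.symm
          · exact hw₁
        have hzt : z ∉ t₁ := fun h => hz (hsub _ hw₁ hne₁ ((hm₁ z).1 h))
        refine ⟨u :: t₁, .cons hzuG hd hzt ht₁, ?_, ?_⟩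
        · intro x
          rw [List.mem_cons, hm₁]
          constructor
          · rintro (rfl | h)
            · exact mem_branch_self z _
            · exact hsub _ hw₁ hne₁ h
          · intro h
            rcases eq_or_mem_branch h with h | ⟨w, h2, h3, h4⟩
            · exact Or.inl h
            · exact Or.inr (h1 w h2 h3 ▸ h4)
        · intro x hx
          have hzu1 := dist_eq_one_iff_adj.2 hzuG
          rw [List.length_cons]
          rcases List.mem_cons.1 hx with rfl | hx
          · omega
          · rw [ht₁.dist_out hG hzt hx]
            have := hl₁ x hx
            omega
      · right
        push Not at h1
        obtain ⟨w₂, hw₂, hne₂, hw⟩ := h1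
        rcases hrec w₂ hw₂ hne₂ with ⟨t₂, ht₂, hm₂, -⟩ | ⟨w, a, b, h1, h2, h3, h4, h5⟩
        swap
        · exact ⟨w, a, b, h1, h2, h3, fun x hx => hsub _ hw₂ hne₂ (h4 x hx),
            fun x hx => hsub _ hw₂ hne₂ (h5 x hx)⟩
        have hd := three_le_degree hzuG.symm hw₁ hw₂ hne₁.symm hne₂.symm hw.symm
        refine ⟨u, t₁, t₂, ?_, isThreadAt_iff.2 ⟨hd, ht₁⟩, isThreadAt_iff.2 ⟨hd, ht₂⟩,
          fun x hx => hsub _ hw₁ hne₁ ((hm₁ x).1 hx), fun x hx => hsub _ hw₂ hne₂ ((hm₂ x).1 hx)⟩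
        rintro rfl
        have hdis := disjoint_branch (root_notMem_branch hU hg hvc (hoff _ hw₁))
          (root_notMem_branch hU hg hvc (hoff _ hw₂)) hw₁ hw.symm
        exact Set.disjoint_left.1 hdis (mem_branch_self _ _)
          ((hm₂ _).1 ((hm₁ _).2 (mem_branch_self _ _)))

theorem BranchResolving.exists_thread {S : Set V} (hS : BranchResolving G S) {z u : V}
    (hzu : (offCycle G g vc).Adj z u) (hcyc : ∀ j, vc j ∉ branch G z u)
    (hz : 3 ≤ G.degree z) (hfree : ∀ s ∈ S, s ∉ branch G z u) :
    ∃ t, IsThreadAt G z t ∧ (∀ x, x ∈ t ↔ x ∈ branch G z u) ∧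
      ∀ x ∈ t, G.dist z x ≤ t.length := by
  rcases isTail_or_exists_threads hU hg hvc _ z u le_rfl hzu hcyc with
    ⟨t, h1, h2, h3⟩ | ⟨w, t₁, t₂, h1, h2, h3, h4, h5⟩
  · exact ⟨t, isThreadAt_iff.2 ⟨hz, h1⟩, h2, h3⟩
  · rcases hS w t₁ t₂ h2 h3 h1 with ⟨s, hs, hst⟩ | ⟨s, hs, hst⟩
    · exact absurd (h4 s hst) (hfree s hs)
    · exact absurd (h5 s hst) (hfree s hs)

omit [Fintype V] [DecidableRel G.Adj] hU in
theorem cycle_neighbours_ne (i : ZMod g) : vc (i + 1) ≠ vc (i - 1) := by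
  intro h
  have h := hvc.1 h
  have h2 : ((2 : ℕ) : ZMod g) = ((0 : ℕ) : ZMod g) := by
    have : i + 1 - (i - 1) = 0 := sub_eq_zero.2 h
    push_cast
    rw [← this]; ring
  have := ZMod.natCast_inj_of_lt (by omega) (by omega) h2
  omega

omit [Fintype V] [DecidableRel G.Adj] hU hg in
theorem adj_cycle_pred (i : ZMod g) : G.Adj (vc i) (vc (i - 1)) := by
  have := hvc.2 (i - 1)
  rw [sub_add_cancel] at this
  exact this.symm

omit [Fintype V] [DecidableRel G.Adj] in
theorem offCycle_adj_ne {i : ZMod g} {u : V} (hu : (offCycle G g vc).Adj (vc i) u)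
    (j : ZMod g) : u ≠ vc j := by
  rintro rfl
  have := inTree_cycle hU hg hvc hu.reachable
  exact hu.ne (by rw [this])

theorem three_le_degree_cycle {i : ZMod g} {u : V} (hu : (offCycle G g vc).Adj (vc i) u) :
    3 ≤ G.degree (vc i) :=
  three_le_degree (hvc.2 i) (adj_cycle_pred hvc i) (offCycle_le hu)
    (cycle_neighbours_ne hg hvc i) (offCycle_adj_ne hU hg hvc hu _).symm
    (offCycle_adj_ne hU hg hvc hu _).symm

omit hU in
theorem cycle_notMem_tail {z : V} {t : List V} (ht : IsTail G z t) : ∀ i, vc i ∉ t := by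
  induction ht with
  | @leaf z u h1 h2 =>
    intro i hi
    obtain rfl := List.mem_singleton.1 hi
    exact cycle_neighbours_ne hg hvc i
      ((eq_of_degree_eq_one h2 h1.symm (hvc.2 i)).trans
        (eq_of_degree_eq_one h2 h1.symm (adj_cycle_pred hvc i)).symm)
  | @cons z u t h1 h2 h3 h4 ih =>
    intro i hi
    rcases List.mem_cons.1 hi with rfl | hi
    · obtain ⟨w, r, rfl, hw⟩ := h4.exists_eq_cons
      rcases eq_or_eq_of_degree_le_two h2.le (cycle_neighbours_ne hg hvc i) (hvc.2 i)
        (adj_cycle_pred hvc i) hw with rfl | rfl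
      · exact ih (i + 1) (by simp)
      · exact ih (i - 1) (by simp)
    · exact ih i hi

omit hU in
theorem reachable_of_mem_tail {z : V} {t : List V} (ht : IsTail G z t) :
    ∀ x ∈ t, (offCycle G g vc).Reachable z x := by
  have hcyc := cycle_notMem_tail hg hvc ht
  have hadj : ∀ {z u : V}, G.Adj z u → (∀ i, vc i ≠ u) → (offCycle G g vc).Reachable z u :=
    fun h h' => (offCycle_adj_of_notMem h.symm h').reachable.symm
  induction ht with
  | leaf h1 h2 =>
    intro x hx
    rw [List.mem_singleton.1 hx]
    exact hadj h1 fun i h => hcyc i (by simp [h])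
  | @cons z u t h1 h2 h3 h4 ih =>
    have hzu := hadj h1 fun i h => hcyc i (by simp [h])
    intro x hx
    rcases List.mem_cons.1 hx with rfl | hx
    · exact hzu
    · exact hzu.trans (ih (fun i h => hcyc i (List.mem_cons_of_mem _ h)) x hx)

/-- Every branch-active cycle vertex is active for each branch-resolving set. -/
theorem BranchResolving.sActive {S : Set V} (hS : BranchResolving G S) {i : ZMod g}
    (hi : BranchActive G g vc i) : SActive G g vc S i := by
  by_contra hna
  have hfree : ∀ s ∈ S, ¬ inTree G g vc i s := fun s hs h => hna ⟨s, hs, h⟩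
  have hthread : ∀ u, (offCycle G g vc).Adj (vc i) u →
      ∃ t, IsThreadAt G (vc i) t ∧ ∀ x, x ∈ t ↔ x ∈ branch G (vc i) u := by
    intro u hu
    obtain ⟨t, h1, h2, -⟩ := hS.exists_thread hU hg hvc hu (cycle_notMem_branch hU hg hvc hu)
      (three_le_degree_cycle hU hg hvc hu)
      (fun s hs h => hfree s hs (inTree_of_mem_branch hU hg hvc hu h))
    exact ⟨t, h1, h2⟩
  obtain ⟨x, hx, hbr⟩ := hi
  rcases hbr with ⟨hxc, hd⟩ | ⟨⟨j, rfl⟩, hd⟩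
  · rcases eq_or_mem_branch_of_reachable offCycle_le hx with rfl | ⟨u, hu, hxu⟩
    · exact hxc ⟨i, rfl⟩
    · obtain ⟨t, h1, h2⟩ := hthread u hu
      have := h1.isTail.degree_le_two ((h2 x).2 hxu)
      omega
  · obtain rfl := inTree_cycle hU hg hvc hx
    classical
    have hcard : 1 < ((G.neighborFinset (vc i)) \ {vc (i + 1), vc (i - 1)}).card := by
      have h1 := Finset.le_card_sdiff ({vc (i + 1), vc (i - 1)} : Finset V)
        (G.neighborFinset (vc i))
      have h2 := Finset.card_le_two (a := vc (i + 1)) (b := vc (i - 1))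
      rw [card_neighborFinset_eq_degree] at h1
      omega
    obtain ⟨u₁, hu₁, u₂, hu₂, hne⟩ := Finset.one_lt_card.1 hcard
    have hoff : ∀ u ∈ (G.neighborFinset (vc i)) \ {vc (i + 1), vc (i - 1)},
        (offCycle G g vc).Adj (vc i) u := by
      intro u hu
      simp only [Finset.mem_sdiff, mem_neighborFinset, Finset.mem_insert, Finset.mem_singleton,
        not_or] at hu
      refine offCycle_adj_iff.2 ⟨hu.1, ?_⟩
      rintro ⟨j, hj⟩
      rcases Sym2.eq_iff.1 hj with ⟨h1, h2⟩ | ⟨h1, h2⟩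
      · exact hu.2.1 (by rw [h2, hvc.1 h1])
      · exact hu.2.2 (by rw [h2, hvc.1 h1, add_sub_cancel_right])
    have o₁ := hoff u₁ hu₁
    have o₂ := hoff u₂ hu₂
    obtain ⟨t₁, a₁, b₁⟩ := hthread u₁ o₁
    obtain ⟨t₂, a₂, b₂⟩ := hthread u₂ o₂
    have hdis := disjoint_branch (root_notMem_branch hU hg hvc o₁)
      (root_notMem_branch hU hg hvc o₂) (offCycle_le o₁) hne
    have ht : t₁ ≠ t₂ := by
      rintro rfl
      exact Set.disjoint_left.1 hdis (mem_branch_self _ _)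
        ((b₂ _).1 ((b₁ _).2 (mem_branch_self _ _)))
    rcases hS _ t₁ t₂ a₁ a₂ ht with ⟨s, hs, hst⟩ | ⟨s, hs, hst⟩
    · exact hfree s hs (inTree_of_mem_branch hU hg hvc o₁ ((b₁ s).1 hst))
    · exact hfree s hs (inTree_of_mem_branch hU hg hvc o₂ ((b₂ s).1 hst))

omit hU in
/-- For a smallest branch-resolving set, the active cycle vertices are branch-active. -/
theorem SmallestBR.branchActive {S : Finset V} (hS : SmallestBR G S) {i : ZMod g}
    (hi : SActive G g vc (↑S : Set V) i) : BranchActive G g vc i := by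
  obtain ⟨s, hs, hsi⟩ := hi
  obtain ⟨v, t, t', ht, ht', hne, hst⟩ := hS.exists_threads hs
  have hv : inTree G g vc i v :=
    Reachable.trans hsi (reachable_of_mem_tail hg hvc ht.isTail s hst).symm
  refine ⟨v, hv, ?_⟩
  by_cases hvr : v ∈ Set.range vc
  · refine Or.inr ⟨hvr, ?_⟩
    obtain ⟨j, rfl⟩ := hvr
    obtain ⟨u, r, rfl, hu⟩ := ht.isTail.exists_eq_cons
    obtain ⟨u', r', rfl, hu'⟩ := ht'.isTail.exists_eq_cons
    have huu : u ≠ u' := by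
      rintro rfl
      exact hne (by rw [ht.isTail.eq_of_cons ht'.isTail])
    have c1 : ∀ l, u ≠ vc l := fun l h =>
      cycle_notMem_tail hg hvc ht.isTail l (by simp [h])
    have c2 : ∀ l, u' ≠ vc l := fun l h =>
      cycle_notMem_tail hg hvc ht'.isTail l (by simp [h])
    classical
    rw [← card_neighborFinset_eq_degree]
    have hsub : ({u, u', vc (j + 1), vc (j - 1)} : Finset V) ⊆ G.neighborFinset (vc j) := by
      intro x hx
      simp only [Finset.mem_insert, Finset.mem_singleton] at hx
      rw [mem_neighborFinset]
      rcases hx with rfl | rfl | rfl | rfl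
      · exact hu
      · exact hu'
      · exact hvc.2 j
      · exact adj_cycle_pred hvc j
    refine le_of_eq_of_le ?_ (Finset.card_le_card hsub)
    symm
    rw [Finset.card_insert_of_notMem, Finset.card_insert_of_notMem, Finset.card_pair]
    · exact cycle_neighbours_ne hg hvc j
    · simp [c2]
    · simp [c1, huu]
  · exact Or.inl ⟨hvr, (isThreadAt_iff.1 ht).1⟩

end Resolving

section LowestCommonAncestor

variable {V : Type*} [Fintype V] {G : SimpleGraph V} [DecidableRel G.Adj] {g : ℕ}
  {vc : ZMod g → V} (hU : IsUnicyclic G) (hg : 3 ≤ g) (hvc : IsCycleLabelling G g vc)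
include hU hg hvc

/-- Two vertices of a branch at the same distance from its root lie in two different branches
at their lowest common ancestor, again at the same distance from it. -/
theorem exists_branch_ne {x y : V} (hxy : x ≠ y) (n : ℕ) : ∀ z u : V, G.dist z x = n →
    (offCycle G g vc).Adj z u → (∀ j, vc j ∉ branch G z u) → x ∈ branch G z u →
    y ∈ branch G z u → G.dist z x = G.dist z y →
    ∃ z' u₁ u₂, u₁ ≠ u₂ ∧ (offCycle G g vc).Adj z' u₁ ∧ (offCycle G g vc).Adj z' u₂ ∧
      (∀ j, vc j ∉ branch G z' u₁) ∧ (∀ j, vc j ∉ branch G z' u₂) ∧ x ∈ branch G z' u₁ ∧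
      y ∈ branch G z' u₂ ∧ G.dist z' x = G.dist z' y ∧ 3 ≤ G.degree z' := by
  induction n with
  | zero =>
    intro z u hn hzu _ hx _ _
    have := dist_branch_root hU.1 (offCycle_le hzu) (root_notMem_branch hU hg hvc hzu) hx
    omega
  | succ n ih =>
    intro z u hn hzu hcyc hx hy hd
    have hzuG : G.Adj z u := offCycle_le hzu
    have hz := root_notMem_branch hU hg hvc hzu
    have dx := dist_branch_root hU.1 hzuG hz hx
    have dy := dist_branch_root hU.1 hzuG hz hy
    have hu : ∀ j, vc j ≠ u := by
      rintro j rfl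
      exact hcyc j (mem_branch_self z _)
    have hoff : ∀ w, G.Adj u w → (offCycle G g vc).Adj u w := fun w h =>
      offCycle_adj_of_notMem h hu
    have hsub : ∀ w, G.Adj u w → w ≠ z → branch G u w ⊆ branch G z u := fun w h hne =>
      branch_subset_branch (root_notMem_branch hU hg hvc (hoff w h)) h hne
    have hself : G.dist u u = 0 := dist_self
    rcases eq_or_mem_branch hx with rfl | ⟨w₁, a₁, b₁, c₁⟩
    · exact absurd ((hU.1.dist_eq_zero_iff).1 (by omega : G.dist x y = 0)) hxy
    rcases eq_or_mem_branch hy with rfl | ⟨w₂, a₂, b₂, c₂⟩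
    · exact absurd ((hU.1.dist_eq_zero_iff).1 (by omega : G.dist y x = 0)) hxy.symm
    have hc₁ : ∀ j, vc j ∉ branch G u w₁ := fun j hj => hcyc j (hsub _ a₁ b₁ hj)
    have hc₂ : ∀ j, vc j ∉ branch G u w₂ := fun j hj => hcyc j (hsub _ a₂ b₂ hj)
    by_cases hw : w₁ = w₂
    · subst hw
      exact ih u w₁ (by omega) (hoff _ a₁) hc₁ c₁ c₂ (by omega)
    · exact ⟨u, w₁, w₂, hw, hoff _ a₁, hoff _ a₂, hc₁, hc₂, c₁, c₂, by omega,
        three_le_degree hzuG.symm a₁ a₂ b₁.symm b₂.symm hw⟩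

/-- Two different branches at a vertex cannot contain undistinguished vertices at the same
distance from it. -/
theorem BranchResolving.false_of_branch_ne {S : Set V} (hS : BranchResolving G S)
    {z u₁ u₂ x y : V} (hne : u₁ ≠ u₂) (h₁ : (offCycle G g vc).Adj z u₁)
    (h₂ : (offCycle G g vc).Adj z u₂) (c₁ : ∀ j, vc j ∉ branch G z u₁)
    (c₂ : ∀ j, vc j ∉ branch G z u₂) (hx : x ∈ branch G z u₁) (hy : y ∈ branch G z u₂)
    (hd : G.dist z x = G.dist z y) (hz : 3 ≤ G.degree z)
    (hxy : ∀ s ∈ S, G.dist s x = G.dist s y) : False := by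
  have r₁ := root_notMem_branch hU hg hvc h₁
  have r₂ := root_notMem_branch hU hg hvc h₂
  have hdis := Set.disjoint_left.1 (disjoint_branch r₁ r₂ (offCycle_le h₁) hne)
  have f₁ : ∀ s ∈ S, s ∉ branch G z u₁ := by
    intro s hs hs1
    have e1 := dist_lt_of_mem_branch hU.1 (offCycle_le h₁) r₁ hs1 hx
    have e2 := dist_branch_out hU.1 r₂ (hdis hs1) hy
    have := hxy s hs
    omega
  have f₂ : ∀ s ∈ S, s ∉ branch G z u₂ := by
    intro s hs hs2
    have e1 := dist_lt_of_mem_branch hU.1 (offCycle_le h₂) r₂ hs2 hy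
    have e2 := dist_branch_out hU.1 r₁ (fun h => hdis h hs2) hx
    have := hxy s hs
    omega
  obtain ⟨t₁, a₁, b₁, -⟩ := hS.exists_thread hU hg hvc h₁ c₁ hz f₁
  obtain ⟨t₂, a₂, b₂, -⟩ := hS.exists_thread hU hg hvc h₂ c₂ hz f₂
  have ht : t₁ ≠ t₂ := by
    rintro rfl
    exact hdis hx ((b₂ x).1 ((b₁ x).2 hx))
  rcases hS z t₁ t₂ a₁ a₂ ht with ⟨s, hs, hst⟩ | ⟨s, hs, hst⟩
  · exact f₁ s hs ((b₁ s).1 hst)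
  · exact f₂ s hs ((b₂ s).1 hst)

/-- Vertices of the same tree at the same distance from its root are distinguished. -/
theorem BranchResolving.eq_of_inTree {S : Set V} (hS : BranchResolving G S) {i : ZMod g}
    {x y : V} (hx : inTree G g vc i x) (hy : inTree G g vc i y)
    (hd : G.dist (vc i) x = G.dist (vc i) y) (hxy : ∀ s ∈ S, G.dist s x = G.dist s y) :
    x = y := by
  by_contra hne
  have hself : G.dist (vc i) (vc i) = 0 := dist_self
  rcases eq_or_mem_branch_of_reachable offCycle_le hx with rfl | ⟨u₁, a₁, b₁⟩
  · exact hne ((hU.1.dist_eq_zero_iff).1 (by omega))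
  rcases eq_or_mem_branch_of_reachable offCycle_le hy with rfl | ⟨u₂, a₂, b₂⟩
  · exact hne ((hU.1.dist_eq_zero_iff).1 (by omega)).symm
  have c₁ := cycle_notMem_branch hU hg hvc a₁
  by_cases hu : u₁ = u₂
  · subst hu
    obtain ⟨z, w₁, w₂, h1, h2, h3, h4, h5, h6, h7, h8, h9⟩ :=
      exists_branch_ne hU hg hvc hne _ _ _ rfl a₁ c₁ b₁ b₂ hd
    exact hS.false_of_branch_ne hU hg hvc h1 h2 h3 h4 h5 h6 h7 h8 h9 hxy
  · exact hS.false_of_branch_ne hU hg hvc hu a₁ a₂ c₁ (cycle_notMem_branch hU hg hvc a₂)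
      b₁ b₂ hd (three_le_degree_cycle hU hg hvc a₁) hxy

end LowestCommonAncestor

/-- Two positions on a cycle of length `g`, given by numbers below `g`, are at distances
differing by `δ` from each position in `A`, the first being the closer one. -/
def Skewed (g : ℕ) (A : ℕ → Prop) (i j δ : ℕ) : Prop :=
  i < g ∧ j < g ∧ i ≠ j ∧ ∀ a < g, A a → cyc g a j = cyc g a i + δ

section Obstruction

variable {V : Type*} [Fintype V] {G : SimpleGraph V} [DecidableRel G.Adj] {g : ℕ}
  {vc : ZMod g → V}

/-- The positions of the active cycle vertices. -/
def activeAt (G : SimpleGraph V) (g : ℕ) (vc : ZMod g → V) (S : Set V) (a : ℕ) : Prop :=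
  SActive G g vc S (a : ZMod g)

/-- Two cycle vertices between which `S` sees a constant difference of distances `δ`, which an
`S`-free thread at the nearer one can compensate. -/
def Obstructed (G : SimpleGraph V) [DecidableRel G.Adj] (g : ℕ) (vc : ZMod g → V)
    (S : Set V) : Prop :=
  ∃ i j δ : ℕ, Skewed g (activeAt G g vc S) i j δ ∧
    (1 ≤ δ → ∃ t, IsThreadAt G (vc i) t ∧ SFree S t ∧ δ ≤ t.length)

variable (hU : IsUnicyclic G) (hg : 3 ≤ g) (hvc : IsCycleLabelling G g vc)
include hU hg hvc

omit hU in
theorem IsThreadAt.inTree {i : ZMod g} {t : List V} (ht : IsThreadAt G (vc i) t) :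
    ∀ x ∈ t, inTree G g vc i x :=
  reachable_of_mem_tail hg hvc ht.isTail

theorem Obstructed.not_isVertexMG {S : Set V} (h : Obstructed G g vc S) :
    ¬ IsVertexMG G S := by
  have : NeZero g := ⟨by omega⟩
  obtain ⟨i, j, δ, ⟨hi, hj, hij, hA⟩, ht⟩ := h
  have hne : (i : ZMod g) ≠ j := fun h => hij (ZMod.natCast_inj_of_lt hi hj h)
  obtain ⟨x, hx, hxd, hxS⟩ : ∃ x, inTree G g vc (i : ZMod g) x ∧ G.dist (vc i) x = δ ∧
      ∀ s ∈ S, G.dist s x = G.dist s (vc i) + δ := by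
    rcases Nat.eq_zero_or_pos δ with rfl | hδ
    · exact ⟨vc i, Reachable.refl _, dist_self, fun s _ => rfl⟩
    · obtain ⟨t, h1, h2, h3⟩ := ht hδ
      obtain ⟨x, hx, hxd⟩ := h1.isTail.exists_dist_eq hU.1 hδ h3
      refine ⟨x, h1.inTree hg hvc x hx, hxd, fun s hs => ?_⟩
      rw [h1.isTail.dist_out hU.1 (fun h => h2 s h hs) hx, hxd]
  intro hMG
  obtain ⟨s, hs, hne'⟩ := hMG x (vc j) (by
    rintro rfl
    exact hne (inTree_cycle hU hg hvc hx))
  apply hne'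
  obtain ⟨a, ha⟩ := exists_inTree hU (vc := vc) s
  have e1 := hA a.val a.val_lt (by
    rw [activeAt, ZMod.natCast_zmod_val]
    exact ⟨s, hs, ha⟩)
  have e2 : ∀ l : ℕ, l < g → G.dist s (vc l) = G.dist s (vc a) + cyc g a.val l := by
    intro l hl
    rw [← ZMod.val_natCast_of_lt hl, ← dist_cycle hU hg hvc, ZMod.val_natCast_of_lt hl]
    by_cases hal : a = l
    · subst hal; simp
    · have := dist_of_inTree_ne hU hg hvc hal ha (Reachable.refl (vc l))
      rw [this]; simp
  rw [hxS s hs, e2 i hi, e2 j hj]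
  omega

theorem obstructed_of_undistinguished {S : Set V} (hS : BranchResolving G S)
    (hbi : ∃ a b, a ≠ b ∧ SActive G g vc S a ∧ SActive G g vc S b) {i j : ZMod g} (hij : i ≠ j)
    {x y : V} (hx : inTree G g vc i x) (hy : inTree G g vc j y)
    (hle : G.dist (vc j) y ≤ G.dist (vc i) x) (hxy : ∀ s ∈ S, G.dist s x = G.dist s y) :
    Obstructed G g vc S := by
  have : NeZero g := ⟨by omega⟩
  have hD : 0 < G.dist (vc i) (vc j) := hU.1.pos_dist_of_ne fun h => hij (hvc.1 h)
  have hj : ¬ SActive G g vc S j := by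
    rintro ⟨s, hs, hsj⟩
    have e1 := dist_of_inTree_ne hU hg hvc hij.symm hsj hx
    have e2 := hU.1.dist_triangle (u := s) (v := vc j) (w := y)
    have e3 := hxy s hs
    rw [SimpleGraph.dist_comm (u := vc j)] at e1
    omega
  have hoff : ∀ a, a ≠ i → SActive G g vc S a → G.dist (vc a) (vc j) =
      G.dist (vc a) (vc i) + (G.dist (vc i) x - G.dist (vc j) y) := by
    rintro a hai ⟨s, hs, hsa⟩
    have haj : a ≠ j := by
      rintro rfl
      exact hj ⟨s, hs, hsa⟩
    have e1 := dist_of_inTree_ne hU hg hvc hai hsa hx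
    have e2 := dist_of_inTree_ne hU hg hvc haj hsa hy
    have e3 := hxy s hs
    omega
  have hon : SActive G g vc S i → G.dist (vc i) x = G.dist (vc i) (vc j) + G.dist (vc j) y := by
    rintro ⟨s, hs, hsi⟩
    have e1 := dist_of_inTree_ne hU hg hvc hij hsi hy
    have e2 := hU.1.dist_triangle (u := s) (v := vc i) (w := x)
    have e3 := hxy s hs
    obtain ⟨a, hai, ha⟩ : ∃ a, a ≠ i ∧ SActive G g vc S a := by
      obtain ⟨a, b, hab, ha, hb⟩ := hbi
      by_cases h : a = i
      · exact ⟨b, fun h' => hab (h.trans h'.symm), hb⟩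
      · exact ⟨a, h, ha⟩
    have e4 := hoff a hai ha
    have e5 := hU.1.dist_triangle (u := vc a) (v := vc i) (w := vc j)
    omega
  refine ⟨i.val, j.val, G.dist (vc i) x - G.dist (vc j) y,
    ⟨i.val_lt, j.val_lt, fun h => hij (ZMod.val_injective g h), ?_⟩, ?_⟩
  · intro a hag ha
    rw [← ZMod.val_natCast_of_lt hag, ← dist_cycle hU hg hvc, ← dist_cycle hU hg hvc]
    by_cases hai : (a : ZMod g) = i
    · have := hon (hai ▸ ha)
      rw [hai, SimpleGraph.dist_self]
      omega
    · exact hoff _ hai ha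
  · intro hδ
    rw [ZMod.natCast_zmod_val]
    rcases eq_or_mem_branch_of_reachable offCycle_le hx with rfl | ⟨u, hu, hxu⟩
    · rw [SimpleGraph.dist_self] at hδ
      omega
    · have hfree : ∀ s ∈ S, s ∉ branch G (vc i) u := by
        intro s hs hsu
        have e1 := dist_lt_of_mem_branch hU.1 (offCycle_le hu)
          (root_notMem_branch hU hg hvc hu) hsu hxu
        have hsi := inTree_of_mem_branch hU hg hvc hu hsu
        have e2 := dist_of_inTree_ne hU hg hvc hij hsi hy
        have e3 := hxy s hs
        have e4 := hon ⟨s, hs, hsi⟩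
        omega
      obtain ⟨t, h1, h2, h3⟩ := hS.exists_thread hU hg hvc hu (cycle_notMem_branch hU hg hvc hu)
        (three_le_degree_cycle hU hg hvc hu) hfree
      refine ⟨t, h1, fun v hv hvS => hfree v hvS ((h2 v).1 hv), ?_⟩
      have := h3 x ((h2 x).2 hxu)
      omega

/-- A branch-resolving set with two active vertices is a metric generator, unless obstructed. -/
theorem BranchResolving.isVertexMG {S : Set V} (hS : BranchResolving G S)
    (hbi : ∃ a b, a ≠ b ∧ SActive G g vc S a ∧ SActive G g vc S b)
    (hO : ¬ Obstructed G g vc S) : IsVertexMG G S := by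
  intro x y hne
  by_contra! hxy
  obtain ⟨i, hi⟩ := exists_inTree hU (vc := vc) x
  obtain ⟨j, hj⟩ := exists_inTree hU (vc := vc) y
  by_cases hij : i = j
  · subst hij
    obtain ⟨a, hai, s, hs, hsa⟩ : ∃ a, a ≠ i ∧ SActive G g vc S a := by
      obtain ⟨a, b, hab, ha, hb⟩ := hbi
      by_cases h : a = i
      · exact ⟨b, fun h' => hab (h.trans h'.symm), hb⟩
      · exact ⟨a, h, ha⟩
    have e1 := dist_of_inTree_ne hU hg hvc hai hsa hi
    have e2 := dist_of_inTree_ne hU hg hvc hai hsa hj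
    have e3 := hxy s hs
    exact hne (hS.eq_of_inTree hU hg hvc hi hj (by omega) hxy)
  · rcases le_total (G.dist (vc j) y) (G.dist (vc i) x) with h | h
    · exact hO (obstructed_of_undistinguished hU hg hvc hS hbi hij hi hj h hxy)
    · exact hO (obstructed_of_undistinguished hU hg hvc hS hbi (Ne.symm hij) hj hi h
        fun s hs => (hxy s hs).symm)

end Obstruction

/-- Three positions in `A` such that no arc of the cycle between them exceeds half of it. -/
def GeodesicTriple (g : ℕ) (A : ℕ → Prop) : Prop :=
  ∃ a b c, a < b ∧ b < c ∧ c < g ∧ A a ∧ A b ∧ A c ∧ 2 * b ≤ g + 2 * a ∧ 2 * c ≤ g + 2 * b ∧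
    g + 2 * a ≤ 2 * c

theorem cyc_cases (g a b : ℕ) : cyc g a b = b - a ∧ a ≤ b ∧ 2 * b ≤ g + 2 * a ∨
    cyc g a b = g - (b - a) ∧ a ≤ b ∧ g + 2 * a ≤ 2 * b ∨
    cyc g a b = a - b ∧ b ≤ a ∧ 2 * a ≤ g + 2 * b ∨
    cyc g a b = g - (a - b) ∧ b ≤ a ∧ g + 2 * b ≤ 2 * a := by
  rw [cyc]
  omega

theorem cyc_le_add {g a b i : ℕ} (ha : a < g) (hb : b < g) (hi : i < g) :
    cyc g a b ≤ cyc g a i + cyc g b i := by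
  have h : cyc g a b ≤ b - a + (a - b) ∧ cyc g a b ≤ g - (b - a + (a - b)) := by
    rw [cyc]
    omega
  rcases cyc_cases g a i with h1 | h1 | h1 | h1 <;>
    rcases cyc_cases g b i with h2 | h2 | h2 | h2 <;> omega

/-- Different positions equidistant from `a` are mirror images in `a`. -/
theorem add_eq_of_cyc_eq {g a i j : ℕ} (ha : a < g) (hi : i < g) (hj : j < g) (hij : i ≠ j)
    (h : cyc g a j = cyc g a i) : i + j = 2 * a ∨ i + j = 2 * a + g ∨ i + j + g = 2 * a := by
  rcases cyc_cases g a i with h1 | h1 | h1 | h1 <;>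
    rcases cyc_cases g a j with h2 | h2 | h2 | h2 <;> omega

theorem cyc_add_cyc {g a b j : ℕ} (hab : a ≤ b) (hb : b < g) (hj : j < g)
    (h : 2 * b ≤ g + 2 * a ∧ a ≤ j ∧ j ≤ b ∨ g + 2 * a ≤ 2 * b ∧ (j ≤ a ∨ b ≤ j)) :
    cyc g a j + cyc g b j = cyc g a b := by
  rcases cyc_cases g a b with h1 | h1 | h1 | h1 <;> try omega
  all_goals rcases cyc_cases g a j with h2 | h2 | h2 | h2 <;> try omega
  all_goals rcases cyc_cases g b j with h3 | h3 | h3 | h3 <;> omega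

theorem GeodesicTriple.not_skewed {g : ℕ} {A : ℕ → Prop} (h : GeodesicTriple g A) {i j δ : ℕ} :
    ¬ Skewed g A i j δ := by
  rintro ⟨hi, hj, hij, hA⟩
  obtain ⟨a, b, c, hab, hbc, hcg, ha, hb, hc, h1, h2, h3⟩ := h
  have e1 := hA a (by omega) ha
  have e2 := hA b (by omega) hb
  have e3 := hA c hcg hc
  have hδ : δ = 0 := by
    have t1 := cyc_le_add (i := i) (by omega) (hbc.trans hcg) hi (a := a)
    have t2 := cyc_le_add (i := i) (hbc.trans hcg) hcg hi
    have t3 := cyc_le_add (i := i) (by omega) hcg hi (a := a)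
    by_cases hja : a ≤ j ∧ j ≤ b
    · have := cyc_add_cyc hab.le (by omega) hj (Or.inl ⟨h1, hja⟩)
      omega
    by_cases hjb : b ≤ j ∧ j ≤ c
    · have := cyc_add_cyc hbc.le hcg hj (Or.inl ⟨h2, hjb⟩)
      omega
    · have := cyc_add_cyc (hab.trans hbc).le hcg hj (Or.inr ⟨h3, by omega⟩)
      omega
  subst hδ
  have f1 := add_eq_of_cyc_eq (by omega) hi hj hij e1
  have f2 := add_eq_of_cyc_eq (by omega) hi hj hij e2
  have f3 := add_eq_of_cyc_eq hcg hi hj hij e3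
  omega

theorem exists_geodesicTriple {g a b : ℕ} (hg : 3 ≤ g) (hab : a < b) (hb : b < g) :
    ∃ c < g, ∀ A : ℕ → Prop, A a → A b → A c → GeodesicTriple g A := by
  rcases lt_trichotomy (2 * (b - a)) g with h | h | h
  · by_cases hc : a + (g + 1) / 2 < g
    · exact ⟨_, hc, fun A h1 h2 h3 => ⟨a, b, _, hab, by omega, hc, h1, h2, h3, by omega,
        by omega, by omega⟩⟩
    · exact ⟨a + (g + 1) / 2 - g, by omega, fun A h1 h2 h3 => ⟨_, a, b, by omega, hab, hb, h3,
        h1, h2, by omega, by omega, by omega⟩⟩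
  · exact ⟨a + 1, by omega, fun A h1 h2 h3 => ⟨a, _, b, by omega, by omega, hb, h1, h3, h2,
      by omega, by omega, by omega⟩⟩
  · exact ⟨a + g / 2, by omega, fun A h1 h2 h3 => ⟨a, _, b, by omega, by omega, hb, h1, h3, h2,
      by omega, by omega, by omega⟩⟩

theorem Skewed.position {g k i j δ : ℕ} {A : ℕ → Prop} (h : Skewed g A i j δ) (h0 : A 0)
    (hk : A k) (hk0 : 0 < k) (hkg : 2 * k < g) (hmax : ∀ a < g, A a → a ≤ k) :
    1 ≤ δ ∧ (k ≤ g / 2 - 1 ∧ (k ≤ i ∧ i ≤ g / 2 - 1 ∨ (g + 1) / 2 + k + 1 ≤ i ∧ i ≤ g - 1 ∨ i = 0)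
      ∨ Even g ∧ i ≤ k ∧ δ = g / 2 - k ∧ ∀ a < g, A a → a = 0 ∨ a = k) := by
  obtain ⟨hi, hj, hij, hA⟩ := h
  have e1 := hA 0 (by omega) h0
  have e2 := hA k (by omega) hk
  have hδ : 1 ≤ δ := by
    by_contra h
    have hδ : δ = 0 := by omega
    subst hδ
    have f1 := add_eq_of_cyc_eq (by omega) hi hj hij e1
    have f2 := add_eq_of_cyc_eq (by omega) hi hj hij e2
    omega
  refine ⟨hδ, or_iff_not_imp_left.2 fun hB => ?_⟩
  have hC : Even g ∧ 0 < i ∧ i ≤ k ∧ j = g / 2 + k - i ∧ δ = g / 2 - k := by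
    rw [Nat.even_iff]
    clear hA hmax
    have c1 : cyc g 0 i = i ∧ 2 * i ≤ g ∨ cyc g 0 i = g - i ∧ g ≤ 2 * i := by
      rw [cyc]
      omega
    have c2 : cyc g 0 j = j ∧ 2 * j ≤ g ∨ cyc g 0 j = g - j ∧ g ≤ 2 * j := by
      rw [cyc]
      omega
    rcases c1 with c1 | c1 <;> rcases c2 with c2 | c2 <;>
      rcases cyc_cases g k i with c3 | c3 | c3 | c3 <;> try omega
    all_goals rcases cyc_cases g k j with c4 | c4 | c4 | c4 <;> omega
  obtain ⟨hev, hi0, hik, rfl, hδ'⟩ := hC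
  refine ⟨hev, hik, hδ', fun a ha haA => ?_⟩
  rw [Nat.even_iff] at hev
  have e3 := hA a ha haA
  have := hmax a ha haA
  by_contra hne
  simp only [cyc] at e3
  omega

theorem geodesicTriple_or_antipodal {g k : ℕ} {A : ℕ → Prop} (h0 : A 0) (hk : A k) (hkg : k < g)
    (hk2 : g ≤ 2 * k) (hmax : ∀ a < g, A a → a ≤ k)
    (hgap : ∀ c < g, 0 < c → A c → ∃ a < c, A a ∧ c ≤ g - k + a) :
    GeodesicTriple g A ∨ g = 2 * k ∧ ∀ a < g, A a → a = 0 ∨ a = k := by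
  classical
  have hex : ∃ c, A c ∧ g ≤ 2 * c := ⟨k, hk, hk2⟩
  obtain ⟨hc, hcg⟩ := Nat.find_spec hex
  have hmin := fun m => Nat.find_min hex (m := m)
  have hck : Nat.find hex ≤ k := Nat.find_min' hex ⟨hk, hk2⟩
  generalize Nat.find hex = c at hc hcg hmin hck
  obtain ⟨a, hac, ha, hca⟩ := hgap c (by omega) (by omega) hc
  have ha2 : 2 * a < g := by
    by_contra h
    exact hmin a hac ⟨ha, by omega⟩
  rcases Nat.eq_zero_or_pos a with rfl | hpos
  · by_cases hall : ∀ a < g, A a → a = 0 ∨ a = k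
    · exact Or.inr ⟨by omega, hall⟩
    · push Not at hall
      obtain ⟨b, hb, hbA, hb0, hbk⟩ := hall
      have := hmax b hb hbA
      exact Or.inl ⟨0, b, k, by omega, by omega, hkg, h0, hbA, hk, by omega, by omega, by omega⟩
  · exact Or.inl ⟨0, a, c, hpos, hac, by omega, h0, ha, hc, by omega, by omega, by omega⟩

theorem skewed_antipodal {g k : ℕ} {A : ℕ → Prop} (hg : 3 ≤ g) (hgk : g = 2 * k)
    (hall : ∀ a < g, A a → a = 0 ∨ a = k) : Skewed g A 1 (g - 1) 0 := by
  refine ⟨by omega, by omega, by omega, fun a ha haA => ?_⟩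
  rcases hall a ha haA with rfl | rfl <;> simp only [cyc] <;> omega

theorem exists_skewed_one {g k i : ℕ} {A : ℕ → Prop} (hg : 3 ≤ g) (hk : k ≤ g / 2 - 1)
    (hmax : ∀ a < g, A a → a ≤ k)
    (hi : k ≤ i ∧ i ≤ g / 2 - 1 ∨ (g + 1) / 2 + k + 1 ≤ i ∧ i ≤ g - 1 ∨ i = 0) :
    ∃ j, Skewed g A i j 1 := by
  rcases hi with hi | hi | rfl
  · refine ⟨i + 1, by omega, by omega, by omega, fun a ha haA => ?_⟩
    have := hmax a ha haA
    simp only [cyc]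
    omega
  · refine ⟨i - 1, by omega, by omega, by omega, fun a ha haA => ?_⟩
    have := hmax a ha haA
    simp only [cyc]
    omega
  · refine ⟨g - 1, by omega, by omega, by omega, fun a ha haA => ?_⟩
    have := hmax a ha haA
    simp only [cyc]
    omega

theorem skewed_opposite {g k i : ℕ} {A : ℕ → Prop} (hev : Even g) (hk : k < g / 2) (hi : 0 < i)
    (hik : i < k) (hall : ∀ a < g, A a → a = 0 ∨ a = k) :
    Skewed g A i (g / 2 + k - i) (g / 2 - k) := by
  rw [Nat.even_iff] at hev
  refine ⟨by omega, by omega, by omega, fun a ha haA => ?_⟩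
  rcases hall a ha haA with rfl | rfl <;> simp only [cyc] <;> omega

section Labelling

variable {V : Type*} {G : SimpleGraph V} {g : ℕ} {vc : ZMod g → V}

theorem IsCycleLabelling.rotate (hvc : IsCycleLabelling G g vc) (c : ZMod g) :
    IsCycleLabelling G g (fun i => vc (i + c)) :=
  ⟨fun _ _ h => add_right_cancel (hvc.1 h), fun i => by
    have := hvc.2 (i + c)
    rwa [add_right_comm] at this⟩

theorem range_rotate (vc : ZMod g → V) (c : ZMod g) :
    Set.range (fun i => vc (i + c)) = Set.range vc :=
  (Equiv.addRight c).surjective.range_comp vc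

theorem sActive_rotate (hU : IsUnicyclic G) (hg : 3 ≤ g) (hvc : IsCycleLabelling G g vc)
    {S : Set V} {c i : ZMod g} :
    SActive G g (fun i => vc (i + c)) S i ↔ SActive G g vc S (i + c) := by
  simp only [SActive, inTree, offCycle, cycleEdges_eq hU hg (hvc.rotate c) hvc]

theorem kOf_spec {S : Set V} {a : ℕ} (hag : a < g) (ha : activeAt G g vc S a) :
    kOf G g vc S < g ∧ activeAt G g vc S (kOf G g vc S) ∧
      ∀ b < g, activeAt G g vc S b → b ≤ kOf G g vc S := by
  have hbdd : BddAbove {n : ℕ | n < g ∧ SActive G g vc S (n : ZMod g)} :=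
    ⟨g, fun n hn => hn.1.le⟩
  have hmem := Nat.sSup_mem (s := {n : ℕ | n < g ∧ SActive G g vc S (n : ZMod g)})
    ⟨a, hag, ha⟩ hbdd
  exact ⟨hmem.1, hmem.2, fun b hb hbS => le_csSup hbdd ⟨hb, hbS⟩⟩

theorem exists_canonical (hU : IsUnicyclic G) (hg : 3 ≤ g) (hvc : IsCycleLabelling G g vc)
    {S : Set V} {a : ZMod g} (ha : SActive G g vc S a) :
    ∃ vc', IsCycleLabelling G g vc' ∧ Set.range vc' = Set.range vc ∧ Canonical G g vc' S := by
  let P : (ZMod g → V) → Prop := fun vc' =>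
    IsCycleLabelling G g vc' ∧ Set.range vc' = Set.range vc ∧ SActive G g vc' S 0
  have hP : ∃ vc', P vc' := ⟨fun i => vc (i + a), hvc.rotate a, range_rotate vc a,
    (sActive_rotate hU hg hvc).2 (by rwa [zero_add])⟩
  obtain ⟨vc', ⟨h1, h2, h3⟩, hmin⟩ :=
    exists_minimalFor_of_wellFoundedLT P (fun vc' => kOf G g vc' S) hP
  refine ⟨vc', h1, h2, h1, h3, fun vc'' h4 h5 h6 => ?_⟩
  rcases le_total (kOf G g vc' S) (kOf G g vc'' S) with h | h
  · exact h
  · exact hmin ⟨h4, h5.trans h2, h6⟩ h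

/-- In a canonical labelling, every active vertex but the first one follows an active vertex at
distance at most `g - k`. -/
theorem Canonical.exists_active_lt (hU : IsUnicyclic G) (hg : 3 ≤ g) {S : Set V}
    (hC : Canonical G g vc S) {c : ℕ} (hcg : c < g) (hc0 : 0 < c) (hc : activeAt G g vc S c) :
    ∃ a < c, activeAt G g vc S a ∧ c ≤ g - kOf G g vc S + a := by
  have hrot := hC.1.rotate (c : ZMod g)
  have hact : ∀ {i : ZMod g}, SActive G g (fun i => vc (i + c)) S i ↔ SActive G g vc S (i + c) :=
    sActive_rotate hU hg hC.1
  have h0 : SActive G g (fun i => vc (i + c)) S 0 := hact.2 (by rwa [zero_add])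
  have hle := hC.2.2 _ hrot (range_rotate vc _) h0
  obtain ⟨h1, h2, -⟩ := kOf_spec (a := 0) (by omega) (show activeAt G g _ S 0 by
    rw [activeAt, Nat.cast_zero]; exact h0)
  obtain ⟨h3, -, h4⟩ := kOf_spec hcg hc
  generalize kOf G g (fun i => vc (i + c)) S = m at hle h1 h2
  have h5 : SActive G g vc S ((m + c : ℕ) : ZMod g) := by
    rw [Nat.cast_add]
    exact hact.1 h2
  rcases lt_or_ge (m + c) g with h | h
  · have := h4 _ h h5
    omega
  · refine ⟨m + c - g, by omega, ?_, by omega⟩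
    rw [activeAt, Nat.cast_sub h, ZMod.natCast_self, sub_zero]
    exact h5

theorem aS_eq_two_iff (hg : 3 ≤ g) {S : Set V} {k : ℕ} (hk0 : 0 < k) (hkg : k < g)
    (h0 : activeAt G g vc S 0) (hk : activeAt G g vc S k) :
    aS G g vc S = 2 ↔ ∀ a < g, activeAt G g vc S a → a = 0 ∨ a = k := by
  have : NeZero g := ⟨by omega⟩
  have hne : ((0 : ℕ) : ZMod g) ≠ (k : ZMod g) := fun h => by
    have := ZMod.natCast_inj_of_lt (by omega) hkg h
    omega
  have hsub : {((0 : ℕ) : ZMod g), (k : ZMod g)} ⊆ {i : ZMod g | SActive G g vc S i} := by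
    rintro x (rfl | rfl)
    · exact h0
    · exact hk
  rw [aS]
  constructor
  · intro h2 a hag ha
    have heq := Set.eq_of_subset_of_ncard_le hsub (by rw [h2, Set.ncard_pair hne])
      (Set.toFinite _)
    have hmem : (a : ZMod g) ∈ {i : ZMod g | SActive G g vc S i} := ha
    rw [← heq] at hmem
    rcases hmem with h | h
    · exact Or.inl (ZMod.natCast_inj_of_lt hag (by omega) h)
    · exact Or.inr (ZMod.natCast_inj_of_lt hag hkg h)
  · intro h
    rw [← Set.ncard_pair hne]
    congr 1
    refine (Set.Subset.antisymm hsub ?_).symm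
    intro x hx
    rcases h x.val x.val_lt (by rw [activeAt, ZMod.natCast_zmod_val]; exact hx) with h | h
    · exact Or.inl (by rw [← h, ZMod.natCast_zmod_val])
    · exact Or.inr (by rw [← h, ZMod.natCast_zmod_val]; rfl)

/-- The data of a canonical labelling with at least two active vertices. -/
theorem Canonical.spec (hg : 3 ≤ g) {S : Set V} (hC : Canonical G g vc S)
    (hbi : ∃ a b, a ≠ b ∧ SActive G g vc S a ∧ SActive G g vc S b) :
    activeAt G g vc S 0 ∧ activeAt G g vc S (kOf G g vc S) ∧ 0 < kOf G g vc S ∧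
      kOf G g vc S < g ∧ ∀ a < g, activeAt G g vc S a → a ≤ kOf G g vc S := by
  have : NeZero g := ⟨by omega⟩
  have h0 : activeAt G g vc S 0 := by
    rw [activeAt, Nat.cast_zero]
    exact hC.2.1
  obtain ⟨h1, h2, h3⟩ := kOf_spec (by omega) h0
  refine ⟨h0, h2, Nat.pos_of_ne_zero fun hk => ?_, h1, h3⟩
  obtain ⟨a, b, hab, ha, hb⟩ := hbi
  have ha' := h3 a.val a.val_lt (by rw [activeAt, ZMod.natCast_zmod_val]; exact ha)
  have hb' := h3 b.val b.val_lt (by rw [activeAt, ZMod.natCast_zmod_val]; exact hb)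
  exact hab (ZMod.val_injective g (by omega))

end Labelling

section Configurations

variable {V : Type*} [Fintype V] {G : SimpleGraph V} [DecidableRel G.Adj] {g : ℕ}
  {vc : ZMod g → V} (hU : IsUnicyclic G) (hg : 3 ≤ g)
include hU hg

theorem Obstructed.containsABC {S : Set V} (hC : Canonical G g vc S)
    (hbi : ∃ a b, a ≠ b ∧ SActive G g vc S a ∧ SActive G g vc S b)
    (hO : Obstructed G g vc S) : ContainsABC G g vc S := by
  obtain ⟨h0, hk, hk0, hkg, hmax⟩ := hC.spec hg hbi
  obtain ⟨i, j, δ, hsk, ht⟩ := hO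
  rcases lt_or_ge (2 * kOf G g vc S) g with h | h
  · obtain ⟨hδ, ⟨hkB, hpos⟩ | ⟨hev, hik, hδ', hall⟩⟩ := hsk.position h0 hk hk0 h hmax
    · obtain ⟨t, h1, h2, -⟩ := ht hδ
      exact Or.inr (Or.inl ⟨vc, hC.1, rfl, hC, hkB, i, hpos, t, h1, h2⟩)
    · obtain ⟨t, h1, h2, h3⟩ := ht hδ
      exact Or.inr (Or.inr ⟨vc, hC.1, rfl, hC, (aS_eq_two_iff hg hk0 hkg h0 hk).2 hall, hev,
        by omega, i, hik, t, h1, h2, hδ' ▸ h3⟩)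
  · rcases geodesicTriple_or_antipodal h0 hk hkg h hmax
      (fun c hcg hc0 hc => hC.exists_active_lt hU hg hcg hc0 hc) with hT | ⟨hgk, hall⟩
    · exact absurd hsk hT.not_skewed
    · exact Or.inl ⟨vc, hC.1, rfl, hC, (aS_eq_two_iff hg hk0 hkg h0 hk).2 hall,
        ⟨kOf G g vc S, by omega⟩, by omega⟩

/-- A configuration with respect to one smallest branch-resolving set obstructs all of them. -/
theorem SmallestBR.obstructed {S S' : Finset V} (hS : SmallestBR G S) (hS' : SmallestBR G S')
    (hC : Canonical G g vc (↑S : Set V))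
    (hbi : ∃ a b, a ≠ b ∧ SActive G g vc (↑S : Set V) a ∧ SActive G g vc (↑S : Set V) b)
    (hABC : ConfigA G g vc (↑S : Set V) ∨ ConfigB G g vc (↑S : Set V) ∨
      ConfigC G g vc (↑S : Set V)) : Obstructed G g vc (↑S' : Set V) := by
  have hvc := hC.1
  obtain ⟨h0, hk, hk0, hkg, hmax⟩ := hC.spec hg hbi
  have hact : ∀ a, activeAt G g vc (↑S' : Set V) a → activeAt G g vc (↑S : Set V) a := fun a ha =>
    hS.1.sActive hU hg hvc (hS'.branchActive hg hvc ha)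
  have hmax' : ∀ a < g, activeAt G g vc (↑S' : Set V) a → a ≤ kOf G g vc (↑S : Set V) :=
    fun a hag ha => hmax a hag (hact a ha)
  have hA : aS G g vc (↑S : Set V) = 2 → ∀ a < g, activeAt G g vc (↑S' : Set V) a →
      a = 0 ∨ a = kOf G g vc (↑S : Set V) := fun h a hag ha =>
    (aS_eq_two_iff hg hk0 hkg h0 hk).1 h a hag (hact a ha)
  have hB : ∀ i : ℕ, kOf G g vc (↑S : Set V) ≤ g / 2 - 1 →
      (kOf G g vc (↑S : Set V) ≤ i ∧ i ≤ g / 2 - 1 ∨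
        (g + 1) / 2 + kOf G g vc (↑S : Set V) + 1 ≤ i ∧ i ≤ g - 1 ∨ i = 0) →
      ∀ t, IsThreadAt G (vc i) t → Obstructed G g vc (↑S' : Set V) := by
    intro i hkB hi t ht
    obtain ⟨j, hj⟩ := exists_skewed_one hg hkB hmax' hi
    obtain ⟨t', ht', hf⟩ := hS'.exists_sFree ht
    exact ⟨i, j, 1, hj, fun _ => ⟨t', ht', hf, List.length_pos_iff.2 ht'.1⟩⟩
  have hanti : Even g → kOf G g vc (↑S : Set V) = g / 2 → aS G g vc (↑S : Set V) = 2 →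
      Obstructed G g vc (↑S' : Set V) := fun hev hkg2 h2 => by
    rw [Nat.even_iff] at hev
    exact ⟨1, g - 1, 0, skewed_antipodal hg (by omega) (hA h2), fun h => by omega⟩
  rcases hABC with ⟨h2, hev, hkg2⟩ | ⟨hkB, i, hi, t, ht, -⟩ | ⟨h2, hev, hkg2, i, hik, t, ht, -, hl⟩
  · exact hanti hev hkg2 h2
  · exact hB i hkB hi t ht
  · rcases hkg2.eq_or_lt with hk2 | hk2
    · exact hanti hev hk2 h2
    rcases Nat.eq_zero_or_pos i with rfl | hi0
    · exact hB 0 (by omega) (by omega) t ht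
    rcases hik.eq_or_lt with rfl | hik
    · exact hB _ (by omega) (by omega) t ht
    · refine ⟨i, _, _, skewed_opposite hev hk2 hi0 hik (hA h2), fun _ => ⟨t, ht, ?_, hl⟩⟩
      intro s hst hs
      rcases hA h2 i (by omega) ⟨s, hs, ht.inTree hg hvc s hst⟩ with h | h <;> omega

/-- If a branch-resolving set sees two cycle vertices, one more vertex suffices to make it a
metric generator. -/
theorem BranchResolving.exists_isVertexMG_insert {S : Set V} (hS : BranchResolving G S)
    (hvc : IsCycleLabelling G g vc)
    (hbi : ∃ a b, a ≠ b ∧ SActive G g vc S a ∧ SActive G g vc S b) :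
    ∃ v, IsVertexMG G (insert v S) := by
  have : NeZero g := ⟨by omega⟩
  obtain ⟨a, b, hab, ha, hb⟩ := hbi
  have hval : ∀ {x : ZMod g}, SActive G g vc S x → activeAt G g vc S x.val := fun {x} h => by
    rwa [activeAt, ZMod.natCast_zmod_val]
  have hne : a.val ≠ b.val := fun h => hab (ZMod.val_injective g h)
  have hmono : ∀ v i, SActive G g vc S i → SActive G g vc (insert v S) i :=
    fun v i ⟨s, hs, hi⟩ => ⟨s, Or.inr hs, hi⟩
  obtain ⟨c, hc⟩ : ∃ c : ℕ, ∀ A : ℕ → Prop, A a.val → A b.val → A c → GeodesicTriple g A := by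
    rcases lt_or_gt_of_ne hne with h | h
    · obtain ⟨c, -, hc⟩ := exists_geodesicTriple hg h b.val_lt
      exact ⟨c, hc⟩
    · obtain ⟨c, -, hc⟩ := exists_geodesicTriple hg h a.val_lt
      exact ⟨c, fun A h1 h2 => hc A h2 h1⟩
  have hT : GeodesicTriple g (activeAt G g vc (insert (vc c) S)) :=
    hc _ (hmono _ _ (hval ha)) (hmono _ _ (hval hb)) ⟨vc c, Or.inl rfl, Reachable.refl _⟩
  refine ⟨vc c, BranchResolving.isVertexMG hU hg hvc (fun v t₁ t₂ h1 h2 h3 => ?_)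
    ⟨a, b, hab, hmono _ _ ha, hmono _ _ hb⟩ ?_⟩
  · rcases hS v t₁ t₂ h1 h2 h3 with ⟨s, hs, hst⟩ | ⟨s, hs, hst⟩
    · exact Or.inl ⟨s, Or.inr hs, hst⟩
    · exact Or.inr ⟨s, Or.inr hs, hst⟩
  · rintro ⟨i, j, δ, hsk, -⟩
    exact hT.not_skewed hsk

theorem BranchResolving.biactive {S : Set V} (hS : BranchResolving G S)
    (hvc : IsCycleLabelling G g vc) (hb : 2 ≤ bG G g vc) {vc' : ZMod g → V}
    (hvc' : IsCycleLabelling G g vc') :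
    ∃ a b, a ≠ b ∧ SActive G g vc' S a ∧ SActive G g vc' S b := by
  obtain ⟨a, ha, b, hb', hab⟩ := (Set.one_lt_ncard_iff_nontrivial_and_finite.1 hb).1
  obtain ⟨a', h1, h2⟩ := SActive.transfer hU hg hvc hvc' (hS.sActive hU hg hvc ha)
  obtain ⟨b', h3, h4⟩ := SActive.transfer hU hg hvc hvc' (hS.sActive hU hg hvc hb')
  refine ⟨a', b', ?_, h2, h4⟩
  rintro rfl
  exact hab (hvc.1 (h1.symm.trans h3))

end Configurations

section MetricDim

variable {V : Type*} {G : SimpleGraph V}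

theorem metricDim_le {S : Finset V} (hS : IsVertexMG G (↑S : Set V)) : metricDim G ≤ S.card :=
  Nat.sInf_le ⟨S, rfl, hS⟩

theorem exists_card_eq_metricDim [Fintype V] (hG : G.Connected) :
    ∃ S : Finset V, S.card = metricDim G ∧ IsVertexMG G (↑S : Set V) := by
  refine Nat.sInf_mem (s := {n | ∃ S : Finset V, S.card = n ∧ IsVertexMG G ↑S})
    ⟨_, Finset.univ, rfl, fun u v huv => ⟨u, by simp, ?_⟩⟩
  rw [SimpleGraph.dist_self]
  exact (hG.pos_dist_of_ne huv).ne

end MetricDim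

theorem statement_5 {V : Type*} [Fintype V] [DecidableEq V] (G : SimpleGraph V)
    [DecidableRel G.Adj] (hG : IsUnicyclic G) (g : ℕ) (hg : 3 ≤ g)
    (vc : ZMod g → V) (hvc : IsCycleLabelling G g vc)
    (hb : 2 ≤ bG G g vc) (S : Finset V) (hS : SmallestBR G S) :
    (¬ ContainsABC G g vc ↑S → metricDim G = LG G) ∧
    (ContainsABC G g vc ↑S → metricDim G = LG G + 1) := by
  obtain ⟨S', hcard, hMG⟩ := exists_card_eq_metricDim hG.1
  have hBR := hMG.branchResolving hG.1
  have hle : LG G ≤ metricDim G := hcard ▸ LG_le_card hBR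
  constructor
  · intro hABC
    obtain ⟨a, -, -, ha, -⟩ := hS.1.biactive hG hg hvc hb hvc
    obtain ⟨vc', h1, h2, hC⟩ := exists_canonical hG hg hvc ha
    have hbi := hS.1.biactive hG hg hvc hb h1
    have hMG' := hS.1.isVertexMG hG hg h1 hbi fun hO => hABC (by
      rcases hO.containsABC hG hg hC hbi with ⟨w, w1, w2, w3⟩ | ⟨w, w1, w2, w3⟩ | ⟨w, w1, w2, w3⟩
      · exact Or.inl ⟨w, w1, w2.trans h2, w3⟩
      · exact Or.inr (Or.inl ⟨w, w1, w2.trans h2, w3⟩)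
      · exact Or.inr (Or.inr ⟨w, w1, w2.trans h2, w3⟩))
    exact le_antisymm (hS.card_eq ▸ metricDim_le hMG') hle
  · intro hABC
    obtain ⟨vc', hC, hconf⟩ : ∃ vc', Canonical G g vc' (↑S : Set V) ∧
        (ConfigA G g vc' (↑S : Set V) ∨ ConfigB G g vc' (↑S : Set V) ∨
          ConfigC G g vc' (↑S : Set V)) := by
      rcases hABC with ⟨w, -, -, w3, w4⟩ | ⟨w, -, -, w3, w4⟩ | ⟨w, -, -, w3, w4⟩
      · exact ⟨w, w3, Or.inl w4⟩
      · exact ⟨w, w3, Or.inr (Or.inl w4)⟩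
      · exact ⟨w, w3, Or.inr (Or.inr w4)⟩
    have hbi := hS.1.biactive hG hg hvc hb hC.1
    apply le_antisymm
    · obtain ⟨v, hv⟩ := hS.1.exists_isVertexMG_insert hG hg hC.1 hbi
      rw [← Finset.coe_insert] at hv
      rw [← hS.card_eq]
      exact (metricDim_le hv).trans (Finset.card_insert_le _ _)
    · refine Nat.succ_le_of_lt (lt_of_le_of_ne hle fun heq => ?_)
      have hS' : SmallestBR G S' :=
        ⟨hBR, fun T hT => (hcard.trans (heq.symm.trans hS.card_eq.symm)).trans_le (hS.2 T hT)⟩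
      exact (hS.obstructed hG hg hS' hC hbi hconf).not_isVertexMG hG hg hC.1 hMG
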